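/- arXiv:2008.01385 — 4 statements merged into one kernel-verified Lean document; each statement's English description precedes it below -/
import Mathlib

section
/- For every α > 0 and every H̄ ∈ (0, H₀) there exists a constant p^{H̄}_α > 0 such that P(G^{H,H̄}_α(x)) ≥ 1 − p^{H̄}_α for all x ∈ D and all H ∈ (0, H̄/2]; moreover, for fixed α the constants can be chosen so that p^{H̄}_α → 0 as H̄ ↓ 0. -/
open MeasureTheory ProbabilityTheory Filter Set

/-- One-sided Gaussian tail bound, in terms of an upper bound for the second moment. -/
lemma gaussian_tail_le {Ω : Type*} [MeasurableSpace Ω] {P : Measure Ω} [IsProbabilityMeasure P]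
    {Y : Ω → ℝ} (hY : Measurable Y) {v : NNReal} (hv : P.map Y = gaussianReal 0 v)
    {s t : ℝ} (hs : 0 < s) (hvar : ∫ ω, Y ω * Y ω ∂P ≤ s) (ht : 0 ≤ t) :
    P.real {ω | t ≤ Y ω} ≤ Real.exp (-t ^ 2 / (2 * s)) := by
  have hvs : (v : ℝ) ≤ s := by
    have h1 : ∫ y, y * y ∂(P.map Y) = ∫ ω, Y ω * Y ω ∂P :=
      integral_map hY.aemeasurable (by fun_prop)
    have h2 : Var[fun y => y; gaussianReal 0 v] = v := variance_fun_id_gaussianReal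
    rw [variance_of_integral_eq_zero (by fun_prop) (by simp)] at h2
    rw [hv] at h1
    simp only [pow_two] at h2
    linarith
  have hsub : HasSubgaussianMGF Y s.toNNReal P := by
    refine ⟨fun u => ?_, fun u => ?_⟩
    · have := integrable_exp_mul_gaussianReal (μ := 0) (v := v) u
      rw [← hv] at this
      exact this.comp_measurable hY
    · rw [mgf_gaussianReal hv, Real.coe_toNNReal s hs.le]
      gcongr
      nlinarith [mul_le_mul_of_nonneg_right hvs (sq_nonneg u)]
  simpa [Real.coe_toNNReal s hs.le] using hsub.measure_ge_le ht

theorem stmt_2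
    {d : ℕ} (hd : 1 ≤ d)
    {Ω : Type} [MeasurableSpace Ω] (P : Measure Ω) [IsProbabilityMeasure P]
    (D : Set (EuclideanSpace ℝ (Fin d)))
    (hDopen : IsOpen D) (hDconn : IsConnected D) (hDbdd : Bornology.IsBounded D)
    (H₀ : ℝ) (hH₀ : H₀ ∈ Set.Ioo (0 : ℝ) (1/2))
    (X : ℝ → EuclideanSpace ℝ (Fin d) → Ω → ℝ)
    (hXmeas : Measurable fun p : ℝ × EuclideanSpace ℝ (Fin d) × Ω => X p.1 p.2.1 p.2.2)
    (C : ℝ → ℝ → ℝ) (G : ℝ → ℝ → EuclideanSpace ℝ (Fin d) → EuclideanSpace ℝ (Fin d) → ℝ)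
    (g : EuclideanSpace ℝ (Fin d) → EuclideanSpace ℝ (Fin d) → ℝ)
    (hCpos : ∀ H h : ℝ, H ∈ Set.Ioo 0 H₀ → h ∈ Set.Ioo 0 H₀ → 0 < C H h)
    (hGbdd : ∀ H h : ℝ, H ∈ Set.Ioo 0 H₀ → h ∈ Set.Ioo 0 H₀ →
      ∃ K : ℝ, ∀ x ∈ D, ∀ y ∈ D, |G H h x y| ≤ K)
    (hgauss : ∀ (n : ℕ) (c : Fin n → ℝ) (Hs : Fin n → ℝ) (xs : Fin n → EuclideanSpace ℝ (Fin d)),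
      (∀ i, Hs i ∈ Set.Ioo 0 H₀) → (∀ i, xs i ∈ D) →
      ∃ v : NNReal, P.map (fun ω => ∑ i, c i * X (Hs i) (xs i) ω) = gaussianReal 0 v)
    (hcov : ∀ H h : ℝ, H ∈ Set.Ioo 0 H₀ → h ∈ Set.Ioo 0 H₀ → ∀ x ∈ D, ∀ y ∈ D,
      ∫ ω, X H x ω * X h y ω ∂P =
        C H h * ((1 - ‖x - y‖ ^ (H + h)) / (H + h) + G H h x y))
    (hA1 : ∀ ε > (0 : ℝ), ∃ η > (0 : ℝ), ∀ H h : ℝ,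
      H ∈ Set.Ioo 0 (min η H₀) → h ∈ Set.Ioo 0 (min η H₀) → |C H h - 1| ≤ ε)
    (hgbdd : ∃ K : ℝ, ∀ x ∈ D, ∀ y ∈ D, |g x y| ≤ K)
    (hA2 : ∀ ε > (0 : ℝ), ∃ η > (0 : ℝ), ∀ H h : ℝ,
      H ∈ Set.Ioo 0 (min η H₀) → h ∈ Set.Ioo 0 (min η H₀) →
      ∀ x ∈ D, ∀ y ∈ D, |G H h x y - g x y| ≤ ε)
    :
    ∀ α > (0 : ℝ), ∃ p : ℝ → ℝ,
      (∀ Hb ∈ Set.Ioo (0 : ℝ) H₀, 0 < p Hb ∧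
        ∀ x ∈ D, ∀ H ∈ Set.Ioc (0 : ℝ) (Hb / 2),
          1 - p Hb ≤
            (P {ω | ∀ h ∈ {h : ℝ | ∃ n : ℕ, h = H + 1 / n ∧
                1 / (Hb - H) < (n : ℝ) ∧ (n : ℝ) ≤ 1 / H},
              X h x ω ≤ α / (h + H)}).toReal) ∧
      Tendsto p (nhdsWithin 0 (Set.Ioo 0 H₀)) (nhds 0) := by
  intro α hα
  obtain ⟨η₁, hη₁, hC⟩ := hA1 1 one_pos
  obtain ⟨η₂, hη₂, hG⟩ := hA2 1 one_pos
  obtain ⟨K, hK⟩ := hgbdd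
  have hK1 : 0 < |K| + 1 := by positivity
  set η := min (min η₁ η₂) (1 / (2 * (|K| + 1))) with hη
  have hηpos : 0 < η := by positivity
  have hsec : ∀ h ∈ Ioo 0 (min η H₀), ∀ x ∈ D, ∫ ω, X h x ω * X h x ω ∂P ≤ 2 / h := by
    intro h ⟨h0, hlt⟩ x hx
    have hl : h < H₀ := hlt.trans_le (min_le_right _ _)
    have hlη : h < η := hlt.trans_le (min_le_left _ _)
    have hl1 : h < η₁ := hlη.trans_le ((min_le_left _ _).trans (min_le_left _ _))
    have hl2 : h < η₂ := hlη.trans_le ((min_le_left _ _).trans (min_le_right _ _))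
    have hl3 : h < 1 / (2 * (|K| + 1)) := hlη.trans_le (min_le_right _ _)
    rw [hcov h h ⟨h0, hl⟩ ⟨h0, hl⟩ x hx x hx, sub_self, norm_zero,
      Real.zero_rpow (by positivity), sub_zero]
    have hc := abs_le.1 (hC h h ⟨h0, lt_min hl1 hl⟩ ⟨h0, lt_min hl1 hl⟩)
    have hg := abs_le.1 (hG h h ⟨h0, lt_min hl2 hl⟩ ⟨h0, lt_min hl2 hl⟩ x hx x hx)
    have hk := (abs_le.1 (hK x hx x hx)).2
    have hinv : |K| + 1 ≤ 1 / (h + h) := by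
      rw [lt_div_iff₀ (by positivity)] at hl3
      rw [le_div_iff₀ (by positivity)]
      linarith
    have hle : 1 / (h + h) + G h h x x ≤ 1 / h := by
      have : 1 / h = 1 / (h + h) + 1 / (h + h) := by field_simp
      linarith [le_abs_self K]
    have hcp := hCpos h h ⟨h0, hl⟩ ⟨h0, hl⟩
    calc C h h * (1 / (h + h) + G h h x x) ≤ C h h * (1 / h) := by gcongr
      _ ≤ 2 * (1 / h) := by gcongr; linarith
      _ = 2 / h := by ring
  set r := Real.exp (-(α ^ 2 / 36)) with hr
  have hr0 : 0 < r := Real.exp_pos _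
  have hr1 : r < 1 := by
    rw [hr, ← Real.exp_zero, Real.exp_lt_exp]
    exact neg_lt_zero.2 (by positivity)
  have htail : ∀ Hb ∈ Ioo 0 (min η H₀), ∀ x ∈ D, ∀ H ∈ Ioc (0 : ℝ) (Hb / 2), ∀ n : ℕ,
      1 / (Hb - H) < (n : ℝ) → (n : ℝ) ≤ 1 / H →
      P.real {ω | α / (H + 1 / n + H) ≤ X (H + 1 / n) x ω} ≤ r ^ n := by
    intro Hb ⟨hb0, hb⟩ x hx H ⟨hH0, hH⟩ n hn1 hn2
    have hbH : 0 < Hb - H := by linarith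
    have hn0 : (0 : ℝ) < n := lt_trans (by positivity) hn1
    have hlt : H + 1 / n < Hb := by
      rw [div_lt_comm₀ hbH hn0] at hn1
      linarith
    have hHn : H ≤ 1 / n := by rwa [le_div_comm₀ hH0 hn0]
    have hh : H + 1 / (n : ℝ) ∈ Ioo 0 (min η H₀) := ⟨by positivity, hlt.trans hb⟩
    obtain ⟨v, hv⟩ := hgauss 1 (fun _ => 1) (fun _ => H + 1 / (n : ℝ)) (fun _ => x)
      (fun _ => ⟨hh.1, hh.2.trans_le (min_le_right _ _)⟩) (fun _ => hx)
    simp only [Finset.univ_unique, one_mul, Finset.sum_const, Finset.card_singleton,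
      one_smul] at hv
    have hmeas : Measurable (X (H + 1 / (n : ℝ)) x) :=
      hXmeas.comp (f := fun ω => (H + 1 / (n : ℝ), x, ω)) (by fun_prop)
    refine (gaussian_tail_le hmeas hv (s := 2 * n) (by positivity) ?_ (by positivity)).trans ?_
    · refine (hsec _ hh x hx).trans ?_
      rw [div_le_iff₀ hh.1]
      have : 2 * (n : ℝ) * (H + 1 / n) = 2 * n * H + 2 := by field_simp
      have : 0 ≤ 2 * (n : ℝ) * H := by positivity
      linarith
    · rw [hr, ← Real.exp_nat_mul, Real.exp_le_exp]
      have ht : α * n / 3 ≤ α / (H + 1 / n + H) := by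
        have : α / (3 * (1 / n)) = α * n / 3 := by field_simp
        rw [← this]
        gcongr
        linarith
      have hsq : (α * n / 3) ^ 2 ≤ (α / (H + 1 / n + H)) ^ 2 := by gcongr
      rw [div_le_iff₀ (by positivity)]
      nlinarith
  refine ⟨fun Hb => if Hb < η then r ^ ⌊1 / Hb⌋₊ / (1 - r) else 1, ?_, ?_⟩
  · intro Hb ⟨hb0, hb⟩
    dsimp only
    split_ifs with hbη
    swap
    · exact ⟨one_pos, fun x _ H _ => by simp⟩
    refine ⟨div_pos (pow_pos hr0 _) (sub_pos.2 hr1), fun x hx H hH => ?_⟩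
    set S : Set Ω := {ω | ∀ h ∈ {h : ℝ | ∃ n : ℕ, h = H + 1 / n ∧
      1 / (Hb - H) < (n : ℝ) ∧ (n : ℝ) ≤ 1 / H}, X h x ω ≤ α / (h + H)}
    let B : ℕ → Set Ω := fun n => {ω | (1 / (Hb - H) < (n : ℝ) ∧ (n : ℝ) ≤ 1 / H) ∧
      α / (H + 1 / n + H) ≤ X (H + 1 / n) x ω}
    have hB : ∀ n, P.real (B n) ≤ r ^ n := by
      intro n
      by_cases hn : 1 / (Hb - H) < (n : ℝ) ∧ (n : ℝ) ≤ 1 / H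
      · simpa only [B, hn, and_self, true_and] using
          htail Hb ⟨hb0, lt_min hbη hb⟩ x hx H hH n hn.1 hn.2
      · simp only [B, hn, false_and, ofPred_false, measureReal_empty]
        positivity
    have hcover : Sᶜ ⊆ ⋃ n ∈ Finset.Ico ⌊1 / Hb⌋₊ (⌊1 / H⌋₊ + 1), B n := by
      intro ω hω
      simp only [S, mem_compl_iff, mem_ofPred_eq, not_forall, not_le] at hω
      obtain ⟨h, ⟨n, rfl, hn1, hn2⟩, hω⟩ := hω
      refine mem_iUnion₂.2 ⟨n, Finset.mem_Ico.2 ⟨?_, ?_⟩, ⟨hn1, hn2⟩, hω.le⟩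
      · refine Nat.floor_le_of_le (le_trans ?_ hn1.le)
        have := hH.1
        have := hH.2
        gcongr <;> linarith
      · exact Nat.lt_succ_of_le (Nat.le_floor hn2)
    have hcompl : P.real Sᶜ ≤ r ^ ⌊1 / Hb⌋₊ / (1 - r) :=
      calc P.real Sᶜ ≤ P.real (⋃ n ∈ Finset.Ico ⌊1 / Hb⌋₊ (⌊1 / H⌋₊ + 1), B n) :=
            measureReal_mono hcover (measure_ne_top P _)
        _ ≤ ∑ n ∈ Finset.Ico ⌊1 / Hb⌋₊ (⌊1 / H⌋₊ + 1), P.real (B n) :=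
            measureReal_biUnion_finset_le _ _
        _ ≤ ∑ n ∈ Finset.Ico ⌊1 / Hb⌋₊ (⌊1 / H⌋₊ + 1), r ^ n :=
            Finset.sum_le_sum fun n _ => hB n
        _ ≤ _ := geom_sum_Ico_le_of_lt_one hr0.le hr1
    have hunion : 1 ≤ P.real S + P.real Sᶜ := by
      simpa using measureReal_union_le (μ := P) S Sᶜ
    change _ ≤ P.real S
    linarith
  · have hfloor : Tendsto (fun Hb : ℝ => ⌊1 / Hb⌋₊) (nhdsWithin 0 (Ioo 0 H₀)) atTop := by
      simp only [one_div]
      exact tendsto_nat_floor_atTop.comp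
        (tendsto_inv_nhdsGT_zero.mono_left (nhdsWithin_mono _ Ioo_subset_Ioi_self))
    have hlim := ((tendsto_pow_atTop_nhds_zero_of_lt_one hr0.le hr1).comp hfloor).div_const (1 - r)
    rw [zero_div] at hlim
    refine hlim.congr' ?_
    filter_upwards [mem_nhdsWithin_of_mem_nhds (Iio_mem_nhds hηpos)] with Hb hHb
    simp [mem_Iio.1 hHb]
end

section
/- Let γ > 0 and α > γ. For every ε ∈ (0, α/γ − 1) and every δ > 0 there exists H̄ ∈ (0, H₀) sufficiently small such that E[exp(γ X^H(x) − (γ²/2) E[X^H(x)²]) · 1_{G^{H,H̄}_α(x)}] ≥ 1 − δ for all x ∈ D and all H ∈ (0, H̄/2]; more precisely, the left-hand side is at least 1 − p^{H̄}_{α−γ(1+ε)}, where p^{H̄}_β are constants (depending only on β, H̄ and the constants in Assumption A) satisfying p^{H̄}_β → 0 as H̄ ↓ 0 for fixed β > 0. -/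
open MeasureTheory ProbabilityTheory Filter Set

section GaussianTilting

variable {Ω : Type*} [MeasurableSpace Ω] {P : Measure Ω}

/-- A centered Gaussian random variable is square integrable. -/
lemma memLp_two_of_map_eq_gaussianReal {Y : Ω → ℝ} (hY : Measurable Y) {v : NNReal}
    (h : P.map Y = gaussianReal 0 v) : MemLp Y 2 P := by
  have h2 : MemLp id 2 (P.map Y) := by
    rw [h]
    exact memLp_id_gaussianReal 2
  exact (memLp_map_measure_iff aestronglyMeasurable_id hY.aemeasurable).1 h2

/-- The exponential of a centered Gaussian random variable is integrable. -/
lemma integrable_exp_of_map_eq_gaussianReal {Y : Ω → ℝ} (hY : Measurable Y) {v : NNReal}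
    (h : P.map Y = gaussianReal 0 v) : Integrable (fun ω => Real.exp (Y ω)) P := by
  have h2 : Integrable (fun y : ℝ => Real.exp (1 * y)) (P.map Y) := by
    rw [h]
    exact integrable_exp_mul_gaussianReal 1
  simpa [Function.comp_def] using h2.comp_measurable hY

/-- The exponential moment of a centered Gaussian random variable. -/
lemma integral_exp_of_map_eq_gaussianReal {Y : Ω → ℝ} (hY : Measurable Y) {v : NNReal}
    (h : P.map Y = gaussianReal 0 v) :
    ∫ ω, Real.exp (Y ω) ∂P = Real.exp ((∫ ω, Y ω ^ 2 ∂P) / 2) := by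
  have hvar : ∫ ω, Y ω ^ 2 ∂P = v := by
    have h1 : ∫ y, y ^ 2 ∂(P.map Y) = ∫ ω, Y ω ^ 2 ∂P :=
      integral_map hY.aemeasurable (by fun_prop)
    rw [← h1, h, ← variance_id_gaussianReal (μ := 0) (v := v),
      variance_of_integral_eq_zero aemeasurable_id (by simp)]
    rfl
  have hmgf := mgf_gaussianReal h 1
  simp only [mgf, one_mul] at hmgf
  rw [hmgf, hvar]
  congr 1
  ring

/-- The exponential moment of a linear combination of two jointly Gaussian variables. -/
lemma integral_exp_linear_combination {U V : Ω → ℝ} (hU : Measurable U) (hV : Measurable V)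
    (hgauss : ∀ a b : ℝ, ∃ v, P.map (fun ω => a * U ω + b * V ω) = gaussianReal 0 v)
    (a b : ℝ) :
    Integrable (fun ω => Real.exp (a * U ω + b * V ω)) P ∧
    ∫ ω, Real.exp (a * U ω + b * V ω) ∂P =
      Real.exp ((a ^ 2 * ∫ ω, U ω ^ 2 ∂P) / 2 + a * b * (∫ ω, U ω * V ω ∂P)
        + (b ^ 2 * ∫ ω, V ω ^ 2 ∂P) / 2) := by
  obtain ⟨v, hv⟩ := hgauss a b
  have hY : Measurable (fun ω => a * U ω + b * V ω) := by fun_prop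
  have hU2 : MemLp U 2 P := by
    obtain ⟨w, hw⟩ := hgauss 1 0
    exact memLp_two_of_map_eq_gaussianReal hU (by simpa using hw)
  have hV2 : MemLp V 2 P := by
    obtain ⟨w, hw⟩ := hgauss 0 1
    exact memLp_two_of_map_eq_gaussianReal hV (by simpa using hw)
  refine ⟨integrable_exp_of_map_eq_gaussianReal hY hv, ?_⟩
  rw [integral_exp_of_map_eq_gaussianReal hY hv]
  have hUi : Integrable (fun ω => a ^ 2 * U ω ^ 2) P := hU2.integrable_sq.const_mul _
  have hVi : Integrable (fun ω => b ^ 2 * V ω ^ 2) P := hV2.integrable_sq.const_mul _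
  have hUV : Integrable (fun ω => 2 * a * b * (U ω * V ω)) P :=
    (hU2.integrable_mul hV2).const_mul _
  have hexp : (fun ω => (a * U ω + b * V ω) ^ 2) =
      fun ω => (a ^ 2 * U ω ^ 2 + 2 * a * b * (U ω * V ω)) + b ^ 2 * V ω ^ 2 := by
    funext ω
    ring
  have hUUV : Integrable (fun ω => a ^ 2 * U ω ^ 2 + 2 * a * b * (U ω * V ω)) P := hUi.add hUV
  rw [hexp, integral_add hUUV hVi, integral_add hUi hUV, integral_const_mul,
    integral_const_mul, integral_const_mul]
  congr 1
  ring

/-- Under the tilted weight `exp (γ U - γ² E[U²] / 2)`, the exceedances of finitely many jointly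
Gaussian variables satisfy a Chernoff and union bound. -/
lemma one_sub_sum_le_integral_indicator_exp {ι : Type*} (s : Finset ι) {U : Ω → ℝ}
    {V : ι → Ω → ℝ} (hU : Measurable U) (hV : ∀ i, Measurable (V i))
    (hgauss : ∀ i ∈ s, ∀ a b : ℝ,
      ∃ v, P.map (fun ω => a * U ω + b * V i ω) = gaussianReal 0 v)
    (hgaussU : ∀ a : ℝ, ∃ v, P.map (fun ω => a * U ω) = gaussianReal 0 v)
    (γ : ℝ) {l : ℝ} (hl : 0 ≤ l) (t : ι → ℝ) :
    1 - ∑ i ∈ s, Real.exp (γ * l * (∫ ω, U ω * V i ω ∂P)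
        + (l ^ 2 * ∫ ω, V i ω ^ 2 ∂P) / 2 - l * t i) ≤
      ∫ ω, Set.indicator {ω' | ∀ i ∈ s, V i ω' ≤ t i}
        (fun ω' => Real.exp (γ * U ω' - γ ^ 2 / 2 * ∫ ω'', U ω'' ^ 2 ∂P)) ω ∂P := by
  set σ := ∫ ω'', U ω'' ^ 2 ∂P with hσ
  set f : Ω → ℝ := fun ω' => Real.exp (γ * U ω' - γ ^ 2 / 2 * σ) with hf
  have hf_eq : f = fun ω => Real.exp (γ * U ω + 0 * U ω) * Real.exp (-(γ ^ 2 / 2 * σ)) := by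
    funext ω
    simp only [hf]
    rw [← Real.exp_add]
    congr 1
    ring
  have hUU : ∀ a b : ℝ, ∃ v, P.map (fun ω => a * U ω + b * U ω) = gaussianReal 0 v := by
    intro a b
    simpa only [add_mul] using hgaussU (a + b)
  have hfU := integral_exp_linear_combination hU hU hUU γ 0
  have hf_int : Integrable f P := by
    rw [hf_eq]
    exact hfU.1.mul_const _
  have hf_one : ∫ ω, f ω ∂P = 1 := by
    rw [hf_eq, integral_mul_const, hfU.2, ← Real.exp_add, ← hσ, Real.exp_eq_one_iff]
    ring
  let e : ι → Ω → ℝ := fun i ω => f ω * Real.exp (l * (V i ω - t i))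
  have he_eq : ∀ i, e i = fun ω => Real.exp (γ * U ω + l * V i ω) *
      Real.exp (-(γ ^ 2 / 2 * σ) - l * t i) := by
    intro i
    funext ω
    simp only [e, hf]
    rw [← Real.exp_add, ← Real.exp_add]
    congr 1
    ring
  have he_int : ∀ i ∈ s, Integrable (e i) P := by
    intro i hi
    rw [he_eq]
    exact (integral_exp_linear_combination hU (hV i) (hgauss i hi) γ l).1.mul_const _
  have he_val : ∀ i ∈ s, ∫ ω, e i ω ∂P = Real.exp (γ * l * (∫ ω, U ω * V i ω ∂P)
        + (l ^ 2 * ∫ ω, V i ω ^ 2 ∂P) / 2 - l * t i) := by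
    intro i hi
    rw [he_eq, integral_mul_const,
      (integral_exp_linear_combination hU (hV i) (hgauss i hi) γ l).2, ← Real.exp_add, ← hσ]
    congr 1
    ring
  have hmeas : MeasurableSet {ω' | ∀ i ∈ s, V i ω' ≤ t i} := by
    have : {ω' | ∀ i ∈ s, V i ω' ≤ t i} = ⋂ i ∈ s, {ω' | V i ω' ≤ t i} := by
      ext
      simp
    rw [this]
    exact Finset.measurableSet_biInter s fun i _ => measurableSet_le (hV i) measurable_const
  rw [← hf_one, ← Finset.sum_congr rfl he_val, ← integral_finsetSum s he_int,
    ← integral_sub hf_int (integrable_finsetSum s he_int)]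
  refine integral_mono (hf_int.sub (integrable_finsetSum s he_int)) (hf_int.indicator hmeas) ?_
  intro ω
  have hfpos : 0 < f ω := Real.exp_pos _
  have hepos : ∀ i, 0 < e i ω := fun i => mul_pos hfpos (Real.exp_pos _)
  by_cases hω : ω ∈ {ω' | ∀ i ∈ s, V i ω' ≤ t i}
  · simp only [Set.indicator_of_mem hω]
    linarith [Finset.sum_nonneg fun i (_ : i ∈ s) => (hepos i).le]
  · simp only [Set.indicator_of_notMem hω]
    simp only [Set.mem_ofPred_eq, not_forall, not_le] at hω
    obtain ⟨i, hi, hlt⟩ := hω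
    have h1 : e i ω ≤ ∑ j ∈ s, e j ω :=
      Finset.single_le_sum (f := fun j => e j ω) (fun j _ => (hepos j).le) hi
    have h2 : f ω ≤ e i ω :=
      le_mul_of_one_le_right hfpos.le (Real.one_le_exp (mul_nonneg hl (by linarith)))
    linarith

/-- A finite piece of a geometric series beyond the index `m`, bounded at half the rate. -/
lemma sum_exp_neg_mul_le {c m : ℝ} (hc : 0 < c) (s : Finset ℕ) (hs : ∀ n ∈ s, m ≤ n) :
    ∑ n ∈ s, Real.exp (-(2 * c * n)) ≤ Real.exp (-(c * m)) * (1 - Real.exp (-c))⁻¹ := by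
  have hr : Real.exp (-c) < 1 := by simpa using hc
  have hsum := summable_geometric_of_lt_one (Real.exp_pos (-c)).le hr
  calc ∑ n ∈ s, Real.exp (-(2 * c * n))
      ≤ ∑ n ∈ s, Real.exp (-(c * m)) * Real.exp (-c) ^ n := by
        refine Finset.sum_le_sum fun n hn => ?_
        rw [← Real.exp_nat_mul, ← Real.exp_add]
        refine Real.exp_le_exp.2 ?_
        nlinarith [hs n hn]
    _ = Real.exp (-(c * m)) * ∑ n ∈ s, Real.exp (-c) ^ n := by rw [Finset.mul_sum]
    _ ≤ _ := by
        refine mul_le_mul_of_nonneg_left ?_ (Real.exp_pos _).le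
        rw [← tsum_geometric_of_lt_one (Real.exp_pos (-c)).le hr]
        exact hsum.sum_le_tsum s fun n _ => (pow_pos (Real.exp_pos _) n).le

/-- The tail constant tends to zero with the cutoff. -/
lemma tendsto_exp_neg_mul_inv_mul {c : ℝ} (hc : 0 < c) (K H₀ : ℝ) :
    Tendsto (fun h : ℝ => Real.exp (-(c * h⁻¹)) * K) (nhdsWithin 0 (Set.Ioo 0 H₀)) (nhds 0) := by
  have h1 : Tendsto (fun h : ℝ => h⁻¹) (nhdsWithin 0 (Set.Ioo 0 H₀)) atTop :=
    tendsto_inv_nhdsGT_zero.mono_left (nhdsWithin_mono _ Set.Ioo_subset_Ioi_self)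
  have h2 := (Real.tendsto_exp_neg_atTop_nhds_zero.comp (h1.const_mul_atTop hc)).mul_const K
  simpa [Function.comp_def] using h2

/-- The Chernoff exponent for level `α / (h + H)`, given the covariance bounds. -/
lemma chernoff_exponent_le {γ α ε h H N cov var : ℝ} (hγ : 0 ≤ γ) (hH : 0 < H) (hHh : H ≤ h)
    (hhN : h * N ≤ 2) (hβ : 0 < α - γ * (1 + ε)) (hcov : cov ≤ (1 + ε) / (h + H))
    (hvar : var ≤ 1 / h) :
    γ * ((α - γ * (1 + ε)) / 2) * cov + (((α - γ * (1 + ε)) / 2) ^ 2 * var) / 2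
      - (α - γ * (1 + ε)) / 2 * (α / (h + H)) ≤ -(2 * ((α - γ * (1 + ε)) ^ 2 / 32) * N) := by
  set β := α - γ * (1 + ε) with hβdef
  have hh : 0 < h := hH.trans_le hHh
  have hinv : 1 / (2 * h) ≤ 1 / (h + H) := one_div_le_one_div_of_le (by linarith) (by linarith)
  have hN : N ≤ 2 / h := by
    rw [le_div_iff₀ hh]
    linarith
  have h1 : γ * (β / 2) * cov ≤ γ * (β / 2) * ((1 + ε) / (h + H)) :=
    mul_le_mul_of_nonneg_left hcov (by positivity)
  have h2 : (β / 2) ^ 2 * var ≤ (β / 2) ^ 2 * (1 / h) :=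
    mul_le_mul_of_nonneg_left hvar (by positivity)
  have h3 : β ^ 2 / 2 * (1 / (2 * h)) ≤ β ^ 2 / 2 * (1 / (h + H)) :=
    mul_le_mul_of_nonneg_left hinv (by positivity)
  have h4 : β ^ 2 / 16 * N ≤ β ^ 2 / 16 * (2 / h) :=
    mul_le_mul_of_nonneg_left hN (by positivity)
  have h5 : γ * (β / 2) * ((1 + ε) / (h + H)) - β / 2 * (α / (h + H)) =
      -(β ^ 2 / 2 * (1 / (h + H))) := by
    rw [hβdef]
    ring
  have h6 : 1 / (2 * h) = 1 / h / 2 := by field_simp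
  have h7 : 2 / h = 2 * (1 / h) := by ring
  rw [h6] at h3
  rw [h7] at h4
  nlinarith

end GaussianTilting

theorem stmt_3
    {d : ℕ} (hd : 1 ≤ d)
    {Ω : Type} [MeasurableSpace Ω] (P : Measure Ω) [IsProbabilityMeasure P]
    (D : Set (EuclideanSpace ℝ (Fin d)))
    (hDopen : IsOpen D) (hDconn : IsConnected D) (hDbdd : Bornology.IsBounded D)
    (H₀ : ℝ) (hH₀ : H₀ ∈ Set.Ioo (0 : ℝ) (1/2))
    (X : ℝ → EuclideanSpace ℝ (Fin d) → Ω → ℝ)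
    (hXmeas : Measurable fun p : ℝ × EuclideanSpace ℝ (Fin d) × Ω => X p.1 p.2.1 p.2.2)
    (C : ℝ → ℝ → ℝ) (G : ℝ → ℝ → EuclideanSpace ℝ (Fin d) → EuclideanSpace ℝ (Fin d) → ℝ)
    (g : EuclideanSpace ℝ (Fin d) → EuclideanSpace ℝ (Fin d) → ℝ)
    (hCpos : ∀ H h : ℝ, H ∈ Set.Ioo 0 H₀ → h ∈ Set.Ioo 0 H₀ → 0 < C H h)
    (hGbdd : ∀ H h : ℝ, H ∈ Set.Ioo 0 H₀ → h ∈ Set.Ioo 0 H₀ →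
      ∃ K : ℝ, ∀ x ∈ D, ∀ y ∈ D, |G H h x y| ≤ K)
    (hgauss : ∀ (n : ℕ) (c : Fin n → ℝ) (Hs : Fin n → ℝ) (xs : Fin n → EuclideanSpace ℝ (Fin d)),
      (∀ i, Hs i ∈ Set.Ioo 0 H₀) → (∀ i, xs i ∈ D) →
      ∃ v : NNReal, P.map (fun ω => ∑ i, c i * X (Hs i) (xs i) ω) = gaussianReal 0 v)
    (hcov : ∀ H h : ℝ, H ∈ Set.Ioo 0 H₀ → h ∈ Set.Ioo 0 H₀ → ∀ x ∈ D, ∀ y ∈ D,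
      ∫ ω, X H x ω * X h y ω ∂P =
        C H h * ((1 - ‖x - y‖ ^ (H + h)) / (H + h) + G H h x y))
    (hA1 : ∀ ε > (0 : ℝ), ∃ η > (0 : ℝ), ∀ H h : ℝ,
      H ∈ Set.Ioo 0 (min η H₀) → h ∈ Set.Ioo 0 (min η H₀) → |C H h - 1| ≤ ε)
    (hgbdd : ∃ K : ℝ, ∀ x ∈ D, ∀ y ∈ D, |g x y| ≤ K)
    (hA2 : ∀ ε > (0 : ℝ), ∃ η > (0 : ℝ), ∀ H h : ℝ,
      H ∈ Set.Ioo 0 (min η H₀) → h ∈ Set.Ioo 0 (min η H₀) →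
      ∀ x ∈ D, ∀ y ∈ D, |G H h x y - g x y| ≤ ε)
    :
    ∀ γ > (0 : ℝ), ∀ α > γ,
      ∃ p : ℝ → ℝ → ℝ,
        (∀ β > (0 : ℝ),
          Tendsto (fun Hb => p β Hb) (nhdsWithin 0 (Set.Ioo 0 H₀)) (nhds 0)) ∧
        ∀ ε ∈ Set.Ioo (0 : ℝ) (α / γ - 1), ∀ δ > (0 : ℝ),
          ∃ Hb ∈ Set.Ioo (0 : ℝ) H₀,
            p (α - γ * (1 + ε)) Hb ≤ δ ∧
            ∀ x ∈ D, ∀ H ∈ Set.Ioc (0 : ℝ) (Hb / 2),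
              1 - p (α - γ * (1 + ε)) Hb ≤
                ∫ ω, Set.indicator
                  {ω' | ∀ h ∈ {h : ℝ | ∃ n : ℕ, h = H + 1 / n ∧
                      1 / (Hb - H) < (n : ℝ) ∧ (n : ℝ) ≤ 1 / H},
                    X h x ω' ≤ α / (h + H)}
                  (fun ω' => Real.exp (γ * X H x ω' -
                    γ ^ 2 / 2 * ∫ ω'', (X H x ω'') ^ 2 ∂P)) ω ∂P := by
  intro γ hγ α hα
  refine ⟨fun β Hb => Real.exp (-(β ^ 2 / 32 * Hb⁻¹)) * (1 - Real.exp (-(β ^ 2 / 32)))⁻¹,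
    fun β hβ => tendsto_exp_neg_mul_inv_mul (by positivity) _ _, ?_⟩
  rintro ε ⟨hε, hεα⟩ δ hδ
  have hβ : 0 < α - γ * (1 + ε) := by
    have : (1 + ε) * γ < α := (lt_div_iff₀ hγ).1 (by linarith)
    linarith
  set β := α - γ * (1 + ε) with hβdef
  obtain ⟨K, hK⟩ := hgbdd
  set ε₁ := min ε 1 / 3 with hε₁def
  have hε₁ : 0 < ε₁ := by positivity
  have hε₁ε : 3 * ε₁ ≤ ε := by
    have := min_le_left ε 1
    linarith
  have hε₁1 : 3 * ε₁ ≤ 1 := by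
    have := min_le_right ε 1
    linarith
  obtain ⟨η₁, hη₁, hC⟩ := hA1 ε₁ hε₁
  obtain ⟨η₂, hη₂, hG⟩ := hA2 1 one_pos
  set M := |K| + 1 with hMdef
  have hM : 0 < M := by positivity
  have hcovle : ∀ h H : ℝ, h ∈ Set.Ioo 0 H₀ → H ∈ Set.Ioo 0 H₀ → h < η₁ → H < η₁ → h < η₂ →
      H < η₂ → M * (h + H) ≤ ε₁ → ∀ x ∈ D,
      ∫ ω, X h x ω * X H x ω ∂P ≤ (1 + 3 * ε₁) / (h + H) := by
    intro h H hh hH h1 H1 h2 H2 hMh x hx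
    have hsum : 0 < h + H := add_pos hh.1 hH.1
    have hCle := (abs_le.1 (hC h H ⟨hh.1, lt_min h1 hh.2⟩ ⟨hH.1, lt_min H1 hH.2⟩)).2
    have hGle := (abs_le.1 (hG h H ⟨hh.1, lt_min h2 hh.2⟩ ⟨hH.1, lt_min H2 hH.2⟩ x hx x hx)).2
    have hgle : g x x ≤ |K| := (le_abs_self _).trans ((hK x hx x hx).trans (le_abs_self K))
    rw [hcov h H hh hH x hx x hx, sub_self, norm_zero, Real.zero_rpow hsum.ne', sub_zero]
    have hb : 1 / (h + H) + G h H x x ≤ (1 + ε₁) / (h + H) := by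
      have : M ≤ ε₁ / (h + H) := by rwa [le_div_iff₀ hsum]
      rw [add_div]
      linarith
    calc C h H * (1 / (h + H) + G h H x x)
        ≤ C h H * ((1 + ε₁) / (h + H)) := mul_le_mul_of_nonneg_left hb (hCpos h H hh hH).le
      _ ≤ (1 + ε₁) * ((1 + ε₁) / (h + H)) :=
          mul_le_mul_of_nonneg_right (by linarith) (by positivity)
      _ = (1 + ε₁) * (1 + ε₁) / (h + H) := by ring
      _ ≤ _ := by
          gcongr
          nlinarith
  have hev : ∀ᶠ Hb in nhdsWithin (0 : ℝ) (Set.Ioo 0 H₀),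
      Real.exp (-(β ^ 2 / 32 * Hb⁻¹)) * (1 - Real.exp (-(β ^ 2 / 32)))⁻¹ ≤ δ :=
    ((tendsto_exp_neg_mul_inv_mul (by positivity) _ _).eventually_lt_const hδ).mono
      fun _ h => h.le
  have hsmall : ∀ᶠ Hb in nhdsWithin (0 : ℝ) (Set.Ioo 0 H₀),
      Hb < min (min η₁ η₂) (ε₁ / (2 * M)) :=
    mem_nhdsWithin_of_mem_nhds (Iio_mem_nhds (by positivity))
  have : (nhdsWithin (0 : ℝ) (Set.Ioo 0 H₀)).NeBot := by
    rw [nhdsWithin_Ioo_eq_nhdsGT hH₀.1]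
    infer_instance
  obtain ⟨Hb, ⟨hpδ, hHbs⟩, hHb⟩ := ((hev.and hsmall).and self_mem_nhdsWithin).exists
  refine ⟨Hb, hHb, hpδ, ?_⟩
  rintro x hx H ⟨hH, hHHb⟩
  have hHb1 : Hb < η₁ := hHbs.trans_le ((min_le_left _ _).trans (min_le_left _ _))
  have hHb2 : Hb < η₂ := hHbs.trans_le ((min_le_left _ _).trans (min_le_right _ _))
  have hHb3 : Hb * (2 * M) < ε₁ := (lt_div_iff₀ (by positivity)).1 (hHbs.trans_le (min_le_right _ _))
  have hHlt : H < Hb := by linarith [hHb.1]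
  have hXm : ∀ h, Measurable (X h x) := fun h =>
    hXmeas.comp (measurable_const.prodMk (measurable_const.prodMk measurable_id))
  let s : Finset ℕ := (Finset.range (⌊1 / H⌋₊ + 1)).filter
    fun n => 1 / (Hb - H) < (n : ℝ) ∧ (n : ℝ) ≤ 1 / H
  have hs : ∀ n : ℕ, n ∈ s ↔ 1 / (Hb - H) < (n : ℝ) ∧ (n : ℝ) ≤ 1 / H := by
    intro n
    simp only [s, Finset.mem_filter, Finset.mem_range, and_iff_right_iff_imp]
    exact fun hn => Nat.lt_succ_of_le (Nat.le_floor hn.2)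
  have hn0 : ∀ n ∈ s, 0 < (n : ℝ) := fun n hn =>
    (one_div_pos.2 (sub_pos.2 hHlt)).trans ((hs n).1 hn).1
  have hscale : ∀ n ∈ s, H < H + 1 / n ∧ H + 1 / n < Hb ∧ (H + 1 / n) * n ≤ 2 := by
    intro n hn
    have hpos := hn0 n hn
    have h1 : 1 / (n : ℝ) < Hb - H := (one_div_lt (sub_pos.2 hHlt) hpos).1 ((hs n).1 hn).1
    have h2 : n * H ≤ 1 := (le_div_iff₀ hH).1 ((hs n).1 hn).2
    refine ⟨lt_add_of_pos_right _ (one_div_pos.2 hpos), by linarith, ?_⟩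
    rw [add_mul, one_div_mul_cancel hpos.ne']
    linarith
  have hHmem : H ∈ Set.Ioo 0 H₀ := ⟨hH, hHlt.trans hHb.2⟩
  have hset : {ω' | ∀ h ∈ {h : ℝ | ∃ n : ℕ, h = H + 1 / n ∧
      1 / (Hb - H) < (n : ℝ) ∧ (n : ℝ) ≤ 1 / H}, X h x ω' ≤ α / (h + H)} =
      {ω' | ∀ n ∈ s, X (H + 1 / n) x ω' ≤ α / (H + 1 / n + H)} := by
    ext ω
    constructor
    · exact fun h n hn => h _ ⟨n, rfl, (hs n).1 hn⟩
    · rintro h _ ⟨n, rfl, hn⟩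
      exact h n ((hs n).2 hn)
  rw [hset]
  refine le_trans ?_ (one_sub_sum_le_integral_indicator_exp s
    (V := fun n : ℕ => X (H + 1 / n) x) (hXm H) (fun n => hXm _) ?_ ?_ γ
    (half_pos hβ).le fun n : ℕ => α / (H + 1 / n + H))
  · refine sub_le_sub_left ((Finset.sum_le_sum fun n hn => Real.exp_le_exp.2 ?_).trans
      (sum_exp_neg_mul_le (m := Hb⁻¹) (by positivity) s fun n hn => ?_)) 1
    · obtain ⟨h1, h2, h3⟩ := hscale n hn
      have hhmem : H + 1 / (n : ℝ) ∈ Set.Ioo 0 H₀ := ⟨hH.trans h1, h2.trans hHb.2⟩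
      have hMh : ∀ a b : ℝ, a < Hb → b < Hb → M * (a + b) ≤ ε₁ := by
        intro a b ha hb
        nlinarith
      refine chernoff_exponent_le hγ.le hH h1.le h3 hβ ?_ ?_
      · refine (hcovle H (H + 1 / n) hHmem hhmem (by linarith) (by linarith) (by linarith)
          (by linarith) (hMh _ _ hHlt h2) x hx).trans ?_
        rw [add_comm H (H + 1 / (n : ℝ))]
        have : 0 < H + 1 / (n : ℝ) + H := add_pos hhmem.1 hH
        gcongr
      · have hv := hcovle (H + 1 / n) (H + 1 / n) hhmem hhmem (by linarith) (by linarith)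
          (by linarith) (by linarith) (hMh _ _ h2 h2) x hx
        simp only [← sq] at hv
        refine hv.trans ?_
        rw [div_le_div_iff₀ (by linarith [hhmem.1]) hhmem.1]
        nlinarith [hhmem.1]
    · refine le_trans ?_ ((hs n).1 hn).1.le
      rw [← one_div]
      exact one_div_le_one_div_of_le (sub_pos.2 hHlt) (by linarith)
  · intro n hn a b
    obtain ⟨h1, h2, -⟩ := hscale n hn
    obtain ⟨v, hv⟩ := hgauss 2 ![a, b] ![H, H + 1 / n] ![x, x]
      (by
        intro i
        fin_cases i
        · exact hHmem
        · exact ⟨hH.trans h1, h2.trans hHb.2⟩)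
      (by
        intro i
        fin_cases i <;> exact hx)
    exact ⟨v, by simpa [Fin.sum_univ_two] using hv⟩
  · intro a
    obtain ⟨v, hv⟩ := hgauss 1 ![a] ![H] ![x]
      (by simpa using hHmem) (by simpa using hx)
    exact ⟨v, by simpa using hv⟩
end

section
/- Let A ⊆ D be a Borel set, γ > 0 and α > γ. Then for every ε > 0 there exists H̄ ∈ (0, H₀) sufficiently small such that sup_{0<H≤H̄/2} E[L^{H,H̄}_{α,γ}(A)] ≤ ε. -/
open MeasureTheory ProbabilityTheory Filter Set

/-- Exponential moment and square integrability of a centered Gaussian variable. -/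
theorem centered_gaussian_exp {Ω : Type*} [MeasurableSpace Ω] {P : Measure Ω}
    [IsProbabilityMeasure P] {Z : Ω → ℝ} (hZ : Measurable Z) {v : NNReal}
    (h : P.map Z = gaussianReal 0 v) :
    MemLp Z 2 P ∧
      ∫⁻ ω, ENNReal.ofReal (Real.exp (Z ω)) ∂P =
        ENNReal.ofReal (Real.exp ((∫ ω, Z ω ^ 2 ∂P) / 2)) := by
  have hL : MemLp Z 2 P := by
    have h1 : MemLp (id : ℝ → ℝ) 2 (P.map Z) := by
      rw [h]; exact memLp_id_gaussianReal 2
    exact (memLp_map_measure_iff h1.1 hZ.aemeasurable).1 h1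
  refine ⟨hL, ?_⟩
  have hmean : ∫ ω, Z ω ∂P = 0 := by
    have h1 : ∫ x, x ∂(P.map Z) = ∫ ω, Z ω ∂P :=
      integral_map hZ.aemeasurable aestronglyMeasurable_id
    rw [← h1, h, integral_id_gaussianReal]
  have hsq : ∫ ω, Z ω ^ 2 ∂P = v := by
    have h1 : variance id (P.map Z) = variance Z P := by
      rw [variance_map aemeasurable_id hZ.aemeasurable]; rfl
    rw [h, variance_id_gaussianReal,
      variance_of_integral_eq_zero hZ.aemeasurable hmean] at h1
    exact h1.symm
  have hmgf := mgf_gaussianReal h 1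
  simp only [mgf, one_mul, zero_add, one_pow, mul_one] at hmgf
  have hint : Integrable (fun ω => Real.exp (Z ω)) P := by
    by_contra hc
    rw [integral_undef hc] at hmgf
    exact (Real.exp_pos _).ne hmgf
  rw [← ofReal_integral_eq_lintegral_ofReal hint (ae_of_all _ fun _ => (Real.exp_pos _).le),
    hmgf, hsq]

/-- Exponential moment of a linear combination of two jointly Gaussian variables. -/
theorem lintegral_exp_gaussian_pair {Ω : Type*} [MeasurableSpace Ω] {P : Measure Ω}
    [IsProbabilityMeasure P] {X Y : Ω → ℝ} (hX : Measurable X) (hY : Measurable Y)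
    (h : ∀ a b : ℝ, ∃ v : NNReal, P.map (fun ω => a * X ω + b * Y ω) = gaussianReal 0 v)
    (a b : ℝ) :
    ∫⁻ ω, ENNReal.ofReal (Real.exp (a * X ω + b * Y ω)) ∂P =
      ENNReal.ofReal (Real.exp ((a ^ 2 * ∫ ω, X ω ^ 2 ∂P) / 2
        + a * b * (∫ ω, X ω * Y ω ∂P) + (b ^ 2 * ∫ ω, Y ω * Y ω ∂P) / 2)) := by
  obtain ⟨v, hv⟩ := h a b
  rw [(centered_gaussian_exp (by fun_prop) hv).2]
  have hXL : MemLp X 2 P := by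
    obtain ⟨w, hw⟩ := h 1 0
    simpa using (centered_gaussian_exp (by fun_prop) hw).1
  have hYL : MemLp Y 2 P := by
    obtain ⟨w, hw⟩ := h 0 1
    simpa using (centered_gaussian_exp (by fun_prop) hw).1
  have hXY : Integrable (fun ω => X ω * Y ω) P := hXL.integrable_mul hYL
  have hYY : Integrable (fun ω => Y ω * Y ω) P := hYL.integrable_mul hYL
  have hXX : Integrable (fun ω => X ω ^ 2) P := hXL.integrable_sq
  have : ∫ ω, (a * X ω + b * Y ω) ^ 2 ∂P = a ^ 2 * ∫ ω, X ω ^ 2 ∂P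
      + 2 * a * b * (∫ ω, X ω * Y ω ∂P) + b ^ 2 * ∫ ω, Y ω * Y ω ∂P := by
    rw [← integral_const_mul, ← integral_const_mul, ← integral_const_mul,
      ← integral_add (hXX.const_mul _) (hXY.const_mul _),
      ← integral_add (f := fun ω => a ^ 2 * X ω ^ 2 + 2 * a * b * (X ω * Y ω))
        ((hXX.const_mul _).add (hXY.const_mul _)) (hYY.const_mul _)]
    congr 1; ext ω; ring
  rw [this]; congr 2; ring

/-- The exponent of the Chernoff bound for a bad scale `h`, with slope `δ / 2`. -/
theorem chernoff_exponent_le_s5 {γ δ K H h Hb c₁ c₂ g₁ g₂ : ℝ}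
    (hγ : 0 < γ) (hδ : 0 < δ) (hK : 0 < K) (hH : 0 < H) (hHh : H ≤ h) (hhb : h ≤ Hb)
    (hb₁ : 8 * γ * K * Hb ≤ δ) (hb₂ : 6 * K * Hb ≤ 1)
    (hc₁ : 0 < c₁) (hc₁' : c₁ ≤ 2) (hc₁'' : γ * (c₁ - 1) ≤ δ / 2)
    (hc₂ : 0 < c₂) (hc₂' : c₂ ≤ 3 / 2)
    (hg₁ : g₁ ≤ K) (hg₂ : g₂ ≤ K) :
    γ * (δ / 2) * (c₁ * (1 / (H + h) + g₁))
        + ((δ / 2) ^ 2 * (c₂ * (1 / (h + h) + g₂))) / 2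
        - δ / 2 * ((γ + 2 * δ) / (h + H)) ≤ -(δ ^ 2 / (8 * h)) := by
  have hh : 0 < h := by linarith
  have hcov : γ * (c₁ * (1 / (H + h) + g₁)) - (γ + 2 * δ) / (h + H) ≤ -(δ / (2 * h)) := by
    have h1 : γ * (c₁ * g₁) ≤ γ * (2 * K) := by
      have := mul_le_mul_of_nonneg_left hg₁ hc₁.le
      have := mul_le_mul_of_nonneg_right hc₁' hK.le
      gcongr γ * ?_
      linarith
    have h2 : 2 * γ * K ≤ δ / 2 * (1 / (H + h)) := by
      rw [mul_one_div, le_div_iff₀ (by linarith)]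
      have : 2 * γ * K * (H + h) ≤ 2 * γ * K * (2 * Hb) := by gcongr; linarith
      linarith
    have h3 : γ * (c₁ - 1) * (1 / (H + h)) ≤ δ / 2 * (1 / (H + h)) := by
      have : 0 < 1 / (H + h) := by positivity
      gcongr
    have h4 : δ / (2 * h) ≤ δ * (1 / (H + h)) := by
      rw [mul_one_div]; gcongr; linarith
    have h5 : (γ + 2 * δ) / (h + H) = γ * (1 / (H + h)) + 2 * (δ * (1 / (H + h))) := by
      rw [add_comm h H]; ring
    rw [h5]
    linarith
  have hvar : c₂ * (1 / (h + h) + g₂) ≤ 1 / h := by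
    have h1 : K ≤ 1 / (6 * h) := by
      rw [le_div_iff₀ (by positivity)]
      have : 6 * K * h ≤ 6 * K * Hb := by gcongr
      linarith
    calc c₂ * (1 / (h + h) + g₂) ≤ c₂ * (1 / (h + h) + 1 / (6 * h)) := by gcongr; linarith
      _ ≤ 3 / 2 * (1 / (h + h) + 1 / (6 * h)) := by gcongr
      _ = 1 / h := by field_simp; norm_num
  have e1 := mul_le_mul_of_nonneg_left hcov (by positivity : (0 : ℝ) ≤ δ / 2)
  have e2 := mul_le_mul_of_nonneg_left hvar (by positivity : (0 : ℝ) ≤ (δ / 2) ^ 2 / 2)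
  have e3 : δ / 2 * -(δ / (2 * h)) + (δ / 2) ^ 2 / 2 * (1 / h) = -(δ ^ 2 / (8 * h)) := by
    field_simp; norm_num
  linarith

/-- The exponential weights of the scales finer than `b` are summable with total of order `b`. -/
theorem tsum_exp_tail_le {c b : ℝ} (hc : 0 < c) (hb : 0 < b) (s : Set ℕ)
    (hs : ∀ n ∈ s, 1 / b ≤ (n : ℝ)) :
    ∑' n : ℕ, s.indicator (fun n : ℕ => ENNReal.ofReal (Real.exp (-(c * n)))) n ≤
      ENNReal.ofReal (2 * b / c * ∑' n : ℕ, Real.exp (-(c / 2)) ^ n) := by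
  have hsum : Summable fun n : ℕ => Real.exp (-(c / 2)) ^ n :=
    summable_geometric_of_lt_one (Real.exp_pos _).le (Real.exp_lt_one_iff.2 (by linarith))
  rw [← tsum_mul_left, ENNReal.ofReal_tsum_of_nonneg (fun n => by positivity)
    (hsum.mul_left _)]
  refine ENNReal.tsum_le_tsum fun n => ?_
  by_cases hn : n ∈ s
  · rw [indicator_of_mem hn]
    apply ENNReal.ofReal_le_ofReal
    have h1 : Real.exp (-(c * n)) = Real.exp (-(c / 2 * n)) * Real.exp (-(c / 2)) ^ n := by
      rw [← Real.exp_nat_mul, ← Real.exp_add]; congr 1; ring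
    rw [h1]
    gcongr
    have h2 : c / (2 * b) ≤ c / 2 * n := by
      have := mul_le_mul_of_nonneg_left (hs n hn) (by positivity : (0 : ℝ) ≤ c / 2)
      calc c / (2 * b) = c / 2 * (1 / b) := by field_simp
        _ ≤ _ := this
    have h3 : 0 < c / (2 * b) := by positivity
    calc Real.exp (-(c / 2 * n)) ≤ Real.exp (-(c / (2 * b))) := by gcongr
      _ = (Real.exp (c / (2 * b)))⁻¹ := Real.exp_neg _
      _ ≤ (c / (2 * b))⁻¹ := by
        gcongr
        linarith [Real.add_one_le_exp (c / (2 * b))]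
      _ = 2 * b / c := inv_div _ _
  · rw [indicator_of_notMem hn]; exact zero_le

theorem stmt_5
    {d : ℕ} (hd : 1 ≤ d)
    {Ω : Type} [MeasurableSpace Ω] (P : Measure Ω) [IsProbabilityMeasure P]
    (D : Set (EuclideanSpace ℝ (Fin d)))
    (hDopen : IsOpen D) (hDconn : IsConnected D) (hDbdd : Bornology.IsBounded D)
    (H₀ : ℝ) (hH₀ : H₀ ∈ Set.Ioo (0 : ℝ) (1/2))
    (X : ℝ → EuclideanSpace ℝ (Fin d) → Ω → ℝ)
    (hXmeas : Measurable fun p : ℝ × EuclideanSpace ℝ (Fin d) × Ω => X p.1 p.2.1 p.2.2)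
    (C : ℝ → ℝ → ℝ) (G : ℝ → ℝ → EuclideanSpace ℝ (Fin d) → EuclideanSpace ℝ (Fin d) → ℝ)
    (g : EuclideanSpace ℝ (Fin d) → EuclideanSpace ℝ (Fin d) → ℝ)
    (hCpos : ∀ H h : ℝ, H ∈ Set.Ioo 0 H₀ → h ∈ Set.Ioo 0 H₀ → 0 < C H h)
    (hGbdd : ∀ H h : ℝ, H ∈ Set.Ioo 0 H₀ → h ∈ Set.Ioo 0 H₀ →
      ∃ K : ℝ, ∀ x ∈ D, ∀ y ∈ D, |G H h x y| ≤ K)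
    (hgauss : ∀ (n : ℕ) (c : Fin n → ℝ) (Hs : Fin n → ℝ) (xs : Fin n → EuclideanSpace ℝ (Fin d)),
      (∀ i, Hs i ∈ Set.Ioo 0 H₀) → (∀ i, xs i ∈ D) →
      ∃ v : NNReal, P.map (fun ω => ∑ i, c i * X (Hs i) (xs i) ω) = gaussianReal 0 v)
    (hcov : ∀ H h : ℝ, H ∈ Set.Ioo 0 H₀ → h ∈ Set.Ioo 0 H₀ → ∀ x ∈ D, ∀ y ∈ D,
      ∫ ω, X H x ω * X h y ω ∂P =
        C H h * ((1 - ‖x - y‖ ^ (H + h)) / (H + h) + G H h x y))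
    (hA1 : ∀ ε > (0 : ℝ), ∃ η > (0 : ℝ), ∀ H h : ℝ,
      H ∈ Set.Ioo 0 (min η H₀) → h ∈ Set.Ioo 0 (min η H₀) → |C H h - 1| ≤ ε)
    (hgbdd : ∃ K : ℝ, ∀ x ∈ D, ∀ y ∈ D, |g x y| ≤ K)
    (hA2 : ∀ ε > (0 : ℝ), ∃ η > (0 : ℝ), ∀ H h : ℝ,
      H ∈ Set.Ioo 0 (min η H₀) → h ∈ Set.Ioo 0 (min η H₀) →
      ∀ x ∈ D, ∀ y ∈ D, |G H h x y - g x y| ≤ ε)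
    :
    ∀ (A : Set (EuclideanSpace ℝ (Fin d))), A ⊆ D → MeasurableSet A →
    ∀ γ > (0 : ℝ), ∀ α > γ, ∀ ε > (0 : ℝ),
      ∃ Hb ∈ Set.Ioo (0 : ℝ) H₀,
        ∀ H ∈ Set.Ioc (0 : ℝ) (Hb / 2),
          (∫ ω, (∫ x in A,
              Set.indicator
                ({ω' | ∀ h ∈ {h : ℝ | ∃ n : ℕ, h = H + 1 / n ∧
                    1 / (Hb - H) < (n : ℝ) ∧ (n : ℝ) ≤ 1 / H},
                  X h x ω' ≤ α / (h + H)}ᶜ)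
                (fun ω' => Real.exp (γ * X H x ω' -
                  γ ^ 2 / 2 * ∫ ω'', (X H x ω'') ^ 2 ∂P)) ω) ∂P) ≤ ε := by
  intro A hAD hA γ hγ α hα ε hε
  obtain ⟨K₀, hK₀⟩ := hgbdd
  set δ : ℝ := (α - γ) / 2 with hδdef
  have hδ : 0 < δ := by rw [hδdef]; linarith
  have hαδ : α = γ + 2 * δ := by rw [hδdef]; ring
  obtain ⟨η₁, hη₁, hC⟩ := hA1 (min (1 / 2) (δ / (2 * γ))) (by positivity)
  obtain ⟨η₂, hη₂, hG⟩ := hA2 1 one_pos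
  set K : ℝ := |K₀| + 1 with hKdef
  have hK : 0 < K := by positivity
  set c : ℝ := δ ^ 2 / 16 with hcdef
  have hc : 0 < c := by positivity
  set S : ℝ := ∑' n : ℕ, Real.exp (-(c / 2)) ^ n with hSdef
  have hS : 0 ≤ S := tsum_nonneg fun n => by positivity
  have hvol : volume A ≠ ⊤ := ((hDbdd.subset hAD).measure_lt_top).ne
  set V : ℝ := (volume A).toReal with hVdef
  have hV : 0 ≤ V := ENNReal.toReal_nonneg
  have hH₀pos : 0 < H₀ := hH₀.1
  obtain ⟨Hb, hHb, hb₀, hbη₁, hbη₂, hb₁, hb₂, hb₃⟩ : ∃ Hb : ℝ, 0 < Hb ∧ Hb < H₀ ∧ Hb ≤ η₁ ∧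
      Hb ≤ η₂ ∧ 8 * γ * K * Hb ≤ δ ∧ 6 * K * Hb ≤ 1 ∧ 2 * Hb / c * S * V ≤ ε := by
    have hpos : 0 < 2 / c * S * V + 1 := by positivity
    refine ⟨min (H₀ / 2) (min η₁ (min η₂ (min (δ / (8 * γ * K)) (min (1 / (6 * K))
      (ε / (2 / c * S * V + 1)))))), by positivity, ?_, ?_, ?_, ?_, ?_, ?_⟩
    · exact (min_le_left _ _).trans_lt (by linarith)
    · simp
    · simp
    · rw [mul_comm, ← le_div_iff₀ (by positivity)]; simp
    · rw [mul_comm, ← le_div_iff₀ (by positivity)]; simp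
    · set b := min (H₀ / 2) _ with hb
      have h1 : b ≤ ε / (2 / c * S * V + 1) := by rw [hb]; simp
      have h2 : 0 < b := by rw [hb]; positivity
      rw [le_div_iff₀ hpos] at h1
      have h3 : 2 * b / c * S * V = b * (2 / c * S * V) := by ring
      linarith
  refine ⟨Hb, ⟨hHb, hb₀⟩, fun H hH => ?_⟩
  obtain ⟨hHpos, hHle⟩ := hH
  set s : Set ℕ := {n : ℕ | 1 / (Hb - H) < (n : ℝ) ∧ (n : ℝ) ≤ 1 / H} with hsdef
  have hscale : ∀ n ∈ s, H ≤ H + 1 / (n : ℝ) ∧ H + 1 / (n : ℝ) ≤ Hb ∧ H + 1 / (n : ℝ) < Hb ∧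
      H + 1 / (n : ℝ) ≤ 2 / n ∧ (0 : ℝ) < n ∧ 1 / Hb ≤ (n : ℝ) := by
    rintro n ⟨hn1, hn2⟩
    have hd1 : 0 < Hb - H := by linarith
    have hn : (0 : ℝ) < n := lt_trans (by positivity) hn1
    have h1 : 1 / (n : ℝ) < Hb - H := by
      rw [div_lt_iff₀ hd1] at hn1
      rw [div_lt_iff₀ hn]; linarith
    have h2 : H ≤ 1 / (n : ℝ) := by
      rw [le_div_iff₀ hHpos] at hn2
      rw [le_div_iff₀ hn]; linarith
    refine ⟨by linarith [one_div_pos.2 hn], by linarith, by linarith, ?_, hn, ?_⟩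
    · have : 2 / (n : ℝ) = 1 / n + 1 / n := by ring
      linarith
    · refine le_trans ?_ hn1.le
      exact one_div_le_one_div_of_le hd1 (by linarith)
  have hXm : ∀ h, Measurable fun p : Ω × EuclideanSpace ℝ (Fin d) => X h p.2 p.1 := fun h =>
    hXmeas.comp (by fun_prop : Measurable fun p : Ω × EuclideanSpace ℝ (Fin d) =>
      ((h, p.2, p.1) : ℝ × EuclideanSpace ℝ (Fin d) × Ω))
  have hXx : ∀ h x, Measurable (X h x) := fun h x =>
    (hXm h).comp (by fun_prop : Measurable fun ω : Ω => (ω, x))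
  set m : EuclideanSpace ℝ (Fin d) → ℝ := fun x => ∫ ω, (X H x ω) ^ 2 ∂P with hmdef
  have hm : Measurable m :=
    (StronglyMeasurable.integral_prod_left
      (((hXm H).pow_const 2).stronglyMeasurable) :
        StronglyMeasurable fun x => ∫ ω, (X H x ω) ^ 2 ∂P).measurable
  set F : ℕ → Ω → EuclideanSpace ℝ (Fin d) → ENNReal := fun n ω x =>
    s.indicator (fun n : ℕ => ENNReal.ofReal (Real.exp (γ * X H x ω + δ / 2 * X (H + 1 / n) x ω))
      * ENNReal.ofReal (Real.exp (-(γ ^ 2 / 2 * m x) - δ / 2 * (α / (H + 1 / n + H))))) n with hF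
  have hFm : ∀ n, Measurable (Function.uncurry (F n)) := by
    intro n
    by_cases hn : n ∈ s
    · have h1 := hXm H
      have h2 := hXm (H + 1 / n)
      simp only [hF, indicator_of_mem hn, Function.uncurry_def]
      fun_prop
    · simp only [hF, indicator_of_notMem hn, Function.uncurry_def]
      fun_prop
  have hFint : ∀ n, ∀ x ∈ A, ∫⁻ ω, F n ω x ∂P ≤
      s.indicator (fun n : ℕ => ENNReal.ofReal (Real.exp (-(c * n)))) n := by
    intro n x hx
    by_cases hn : n ∈ s
    swap
    · simp [hF, indicator_of_notMem hn]
    simp only [hF, indicator_of_mem hn]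
    obtain ⟨hs1, hs2, hs3, hs4, hs5, hs6⟩ := hscale n hn
    set h : ℝ := H + 1 / (n : ℝ) with hh
    have hxD := hAD hx
    have hh0 : 0 < h := lt_of_lt_of_le hHpos hs1
    have hhI : h ∈ Set.Ioo 0 H₀ := ⟨hh0, by linarith⟩
    have hHI : H ∈ Set.Ioo 0 H₀ := ⟨hHpos, by linarith⟩
    have hsmall : ∀ η : ℝ, Hb ≤ η → H ∈ Set.Ioo 0 (min η H₀) ∧ h ∈ Set.Ioo 0 (min η H₀) :=
      fun η hη => ⟨⟨hHpos, lt_min (by linarith) (by linarith)⟩,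
        ⟨hh0, lt_min (by linarith) (by linarith)⟩⟩
    have hGK : ∀ H' h' : ℝ, H' ∈ Set.Ioo 0 (min η₂ H₀) → h' ∈ Set.Ioo 0 (min η₂ H₀) →
        G H' h' x x ≤ K := by
      intro H' h' hH' hh'
      have h1 := (abs_le.1 (hG H' h' hH' hh' x hxD x hxD)).2
      have h2 := (abs_le.1 (hK₀ x hxD x hxD)).2
      have h3 := le_abs_self K₀
      rw [hKdef]; linarith
    rw [lintegral_mul_const' _ _ ENNReal.ofReal_ne_top,
      lintegral_exp_gaussian_pair (hXx H x) (hXx h x) ?_ γ (δ / 2),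
      ← ENNReal.ofReal_mul (Real.exp_pos _).le, ← Real.exp_add]
    swap
    · intro a b
      obtain ⟨v, hv⟩ := hgauss 2 ![a, b] ![H, h] ![x, x]
        (by intro i; fin_cases i <;> simpa) (by intro i; fin_cases i <;> simpa)
      exact ⟨v, by simpa [Fin.sum_univ_two] using hv⟩
    apply ENNReal.ofReal_le_ofReal
    apply Real.exp_le_exp.2
    have hz : ∀ t : ℝ, 0 < t → ‖x - x‖ ^ t = 0 := fun t ht => by
      rw [sub_self, norm_zero, Real.zero_rpow ht.ne']
    rw [hcov H h hHI hhI x hxD x hxD, hcov h h hhI hhI x hxD x hxD,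
      hz _ (by linarith), hz _ (by linarith), sub_zero]
    obtain ⟨i1, i2⟩ := hsmall η₁ hbη₁
    obtain ⟨j1, j2⟩ := hsmall η₂ hbη₂
    have c1 := (abs_le.1 (hC H h i1 i2)).2
    have c2 := (abs_le.1 (hC h h i2 i2)).2
    have d1 := c1.trans (min_le_left _ _)
    have d2 := c2.trans (min_le_left _ _)
    have d3 : γ * (C H h - 1) ≤ δ / 2 := by
      calc γ * (C H h - 1) ≤ γ * (δ / (2 * γ)) := by
            gcongr; exact c1.trans (min_le_right _ _)
        _ = δ / 2 := by field_simp
    have key := chernoff_exponent_le_s5 hγ hδ hK hHpos hs1 hs2 hb₁ hb₂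
      (hCpos H h hHI hhI) (by linarith) d3 (hCpos h h hhI hhI) (by linarith)
      (hGK H h j1 j2) (hGK h h j2 j2)
    have hfin : c * n ≤ δ ^ 2 / (8 * h) := by
      rw [le_div_iff₀ (by positivity), hcdef]
      rw [le_div_iff₀ hs5] at hs4
      nlinarith [sq_nonneg δ, mul_le_mul_of_nonneg_left hs4 (sq_nonneg δ)]
    rw [hαδ]
    have hmx : m x = ∫ ω, (X H x ω) ^ 2 ∂P := rfl
    rw [← hmx]
    linarith
  have hpt : ∀ ω, ∀ x, ‖Set.indicator
      ({ω' | ∀ h ∈ {h : ℝ | ∃ n : ℕ, h = H + 1 / n ∧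
          1 / (Hb - H) < (n : ℝ) ∧ (n : ℝ) ≤ 1 / H}, X h x ω' ≤ α / (h + H)}ᶜ)
      (fun ω' => Real.exp (γ * X H x ω' - γ ^ 2 / 2 * ∫ ω'', (X H x ω'') ^ 2 ∂P)) ω‖ₑ ≤
      ∑' n, F n ω x := by
    intro ω x
    by_cases hω : ω ∈ ({ω' | ∀ h ∈ {h : ℝ | ∃ n : ℕ, h = H + 1 / n ∧
          1 / (Hb - H) < (n : ℝ) ∧ (n : ℝ) ≤ 1 / H}, X h x ω' ≤ α / (h + H)}ᶜ)
    swap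
    · rw [indicator_of_notMem hω]; simp
    rw [indicator_of_mem hω]
    simp only [mem_compl_iff, mem_ofPred_eq, not_forall, not_le] at hω
    obtain ⟨h, ⟨n, rfl, hn⟩, hlt⟩ := hω
    refine le_trans ?_ (ENNReal.le_tsum n)
    have hns : n ∈ s := hn
    simp only [hF, indicator_of_mem hns]
    rw [Real.enorm_eq_ofReal (Real.exp_pos _).le, ← ENNReal.ofReal_mul (Real.exp_pos _).le,
      ← Real.exp_add]
    apply ENNReal.ofReal_le_ofReal
    apply Real.exp_le_exp.2
    have hmx : m x = ∫ ω, (X H x ω) ^ 2 ∂P := rfl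
    rw [← hmx]
    have := mul_le_mul_of_nonneg_left hlt.le (by positivity : (0 : ℝ) ≤ δ / 2)
    linarith
  refine (le_abs_self _).trans ?_
  rw [← Real.norm_eq_abs, ← toReal_enorm]
  refine ENNReal.toReal_le_of_le_ofReal hε.le ?_
  calc _ ≤ ∫⁻ ω, (∫⁻ x in A, ∑' n, F n ω x) ∂P := by
        refine (enorm_integral_le_lintegral_enorm _).trans (lintegral_mono fun ω => ?_)
        exact (enorm_integral_le_lintegral_enorm _).trans (lintegral_mono (hpt ω))
    _ = ∫⁻ x in A, (∫⁻ ω, ∑' n, F n ω x ∂P) :=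
        lintegral_lintegral_swap
          (by
            have := Measurable.tsum (L := .unconditional ℕ) hFm
            simpa only [Function.uncurry_def] using this.aemeasurable)
    _ = ∫⁻ x in A, (∑' n, ∫⁻ ω, F n ω x ∂P) := by
        congr 1; ext x
        exact lintegral_tsum fun n =>
          ((hFm n).comp (by fun_prop : Measurable fun ω : Ω => (ω, x))).aemeasurable
    _ ≤ ∫⁻ _ in A, ENNReal.ofReal (2 * Hb / c * S) := by
        refine setLIntegral_mono' hA fun x hx => ?_
        exact (ENNReal.tsum_le_tsum fun n => hFint n x hx).trans
          (tsum_exp_tail_le hc hHb s fun n hn => (hscale n hn).2.2.2.2.2)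
    _ = ENNReal.ofReal (2 * Hb / c * S * V) := by
        rw [setLIntegral_const, ENNReal.ofReal_mul (p := 2 * Hb / c * S) (by positivity), hVdef,
          ENNReal.ofReal_toReal hvol]
    _ ≤ ENNReal.ofReal ε := ENNReal.ofReal_le_ofReal hb₃
end

section
/- There exist κ* > 1 and γ*(d) > √(7d/4) such that for every γ ∈ (0, γ*(d)] and every α > γ sufficiently close to γ there exists H̄ ∈ (0, H₀) with sup_{0<H≤H̄/2} J₂(H, H̄) < ∞. -/
open MeasureTheory ProbabilityTheory Filter Set

lemma memLp_of_map_eq_gaussianReal {Ω : Type*} [MeasurableSpace Ω] {P : Measure Ω} {Z : Ω → ℝ}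
    (hZ : Measurable Z) {v : NNReal} (h : P.map Z = gaussianReal 0 v) : MemLp Z 2 P := by
  have := memLp_id_gaussianReal (μ := 0) (v := v) 2
  rw [← h, memLp_map_measure_iff (by fun_prop) hZ.aemeasurable] at this
  simpa [Function.comp_def] using this

lemma setIntegral_exp_tilt_le {Ω : Type*} [MeasurableSpace Ω] (P : Measure Ω)
    [IsProbabilityMeasure P] {W Y : Ω → ℝ} (hW : Measurable W) (hY : Measurable Y)
    (hG : ∀ p q : ℝ, ∃ v : NNReal, P.map (fun ω => p * W ω + q * Y ω) = gaussianReal 0 v)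
    {S : Set Ω} {β t γ : ℝ} (ht : 0 ≤ t) (hS : ∀ ω ∈ S, Y ω ≤ β) :
    ∫ ω in S, Real.exp (γ * W ω - γ ^ 2 / 2 * ∫ ω', W ω' ^ 2 ∂P) ∂P ≤
      Real.exp (-(γ * t * ∫ ω, W ω * Y ω ∂P) + t ^ 2 / 2 * (∫ ω, Y ω ^ 2 ∂P) + t * β) := by
  have key : ∀ p q : ℝ, Integrable (fun ω => Real.exp (p * W ω + q * Y ω)) P ∧
      MemLp (fun ω => p * W ω + q * Y ω) 2 P ∧
      ∫ ω, Real.exp (p * W ω + q * Y ω) ∂P =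
        Real.exp ((∫ ω, (p * W ω + q * Y ω) ^ 2 ∂P) / 2) := by
    intro p q
    obtain ⟨v, hv⟩ := hG p q
    have hm : Measurable (fun ω => p * W ω + q * Y ω) := by fun_prop
    have h1 : Integrable (fun ω => Real.exp (p * W ω + q * Y ω)) P := by
      have := integrable_exp_mul_gaussianReal (μ := 0) (v := v) 1
      rw [← hv, integrable_map_measure (by fun_prop) hm.aemeasurable] at this
      simpa [Function.comp_def] using this
    have h2 := memLp_of_map_eq_gaussianReal hm hv
    refine ⟨h1, h2, ?_⟩
    have h3 := mgf_gaussianReal hv 1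
    have h4 : ∫ ω, (p * W ω + q * Y ω) ^ 2 ∂P = v := by
      have h5 := variance_id_gaussianReal (μ := 0) (v := v)
      rw [variance_of_integral_eq_zero (by fun_prop) (by simp), ← hv,
        integral_map hm.aemeasurable (by fun_prop)] at h5
      simpa using h5
    rw [h4]
    simpa [mgf] using h3
  have hW2 : MemLp W 2 P := by simpa using (key 1 0).2.1
  have hY2 : MemLp Y 2 P := by simpa using (key 0 1).2.1
  set σ := ∫ ω', W ω' ^ 2 ∂P with hσ
  have hbound := ((key γ (-t)).1.mul_const (Real.exp (t * β - γ ^ 2 / 2 * σ)))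
  calc ∫ ω in S, Real.exp (γ * W ω - γ ^ 2 / 2 * σ) ∂P
      ≤ ∫ ω in {ω | Y ω ≤ β}, Real.exp (γ * W ω - γ ^ 2 / 2 * σ) ∂P := by
        refine setIntegral_mono_set (Integrable.integrableOn ?_)
          (ae_of_all _ fun ω => (Real.exp_pos _).le) (LE.le.eventuallyLE hS)
        have := (key γ 0).1.mul_const (Real.exp (-(γ ^ 2 / 2 * σ)))
        simpa [← Real.exp_add, sub_eq_add_neg] using this
    _ ≤ ∫ ω in {ω | Y ω ≤ β},
          Real.exp (γ * W ω + -t * Y ω) * Real.exp (t * β - γ ^ 2 / 2 * σ) ∂P := by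
        refine integral_mono_of_nonneg (ae_of_all _ fun ω => (Real.exp_pos _).le)
          hbound.integrableOn ?_
        refine ae_restrict_of_forall_mem (measurableSet_le hY measurable_const) fun ω hω => ?_
        dsimp only
        rw [← Real.exp_add]
        apply Real.exp_le_exp.2
        have : t * Y ω ≤ t * β := mul_le_mul_of_nonneg_left hω ht
        linarith
    _ ≤ ∫ ω, Real.exp (γ * W ω + -t * Y ω) * Real.exp (t * β - γ ^ 2 / 2 * σ) ∂P :=
        setIntegral_le_integral hbound (ae_of_all _ fun ω => by positivity)
    _ = _ := by
        rw [integral_mul_const, (key γ (-t)).2.2, ← Real.exp_add]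
        congr 1
        have e : ∫ ω, (γ * W ω + -t * Y ω) ^ 2 ∂P =
            γ ^ 2 * σ - 2 * γ * t * (∫ ω, W ω * Y ω ∂P) + t ^ 2 * ∫ ω, Y ω ^ 2 ∂P := by
          have i1 : Integrable (fun ω => W ω ^ 2) P := hW2.integrable_sq
          have i2 : Integrable (fun ω => Y ω ^ 2) P := hY2.integrable_sq
          have i3 : Integrable (fun ω => W ω * Y ω) P := hW2.integrable_mul hY2
          have hexp : (fun ω => (γ * W ω + -t * Y ω) ^ 2) = fun ω =>
              (γ ^ 2 * W ω ^ 2 - 2 * γ * t * (W ω * Y ω)) + t ^ 2 * Y ω ^ 2 := by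
            ext ω; ring
          rw [hexp, integral_add (f := fun ω => γ ^ 2 * W ω ^ 2 - 2 * γ * t * (W ω * Y ω))
              ((i1.const_mul _).sub (i3.const_mul _)) (i2.const_mul _),
            integral_sub (i1.const_mul _) (i3.const_mul _), integral_const_mul,
            integral_const_mul, integral_const_mul]
        rw [e]; ring

/-- The function `s ↦ (1 - exp (-s)) / s`. -/
noncomputable def expQuot (s : ℝ) : ℝ := (1 - Real.exp (-s)) / s

lemma expQuot_nonneg {s : ℝ} (hs : 0 < s) : 0 ≤ expQuot s := by
  have : Real.exp (-s) ≤ 1 := Real.exp_le_one_iff.2 (by linarith)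
  exact div_nonneg (by linarith) hs.le

lemma expQuot_le_one {s : ℝ} (hs : 0 < s) : expQuot s ≤ 1 := by
  rw [expQuot, div_le_one hs]
  linarith [Real.add_one_le_exp (-s)]

lemma expQuot_sub_le {s δ : ℝ} (hs : 1 ≤ s) (hδ : 0 ≤ δ) : expQuot s - δ ≤ expQuot (s + δ) := by
  have h1 : Real.exp (-(s + δ)) ≤ Real.exp (-s) := Real.exp_le_exp.2 (by linarith)
  have h0 := Real.exp_pos (-s)
  have h2 : Real.exp (-s) ≤ 1 := Real.exp_le_one_iff.2 (by linarith)
  have h3 : expQuot s * s = 1 - Real.exp (-s) := by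
    rw [expQuot]; field_simp
  have h4 := expQuot_le_one (s := s) (by linarith)
  rw [expQuot.eq_def (s + δ), le_div_iff₀ (by linarith)]
  nlinarith [mul_nonneg hδ (sub_nonneg.2 h4), mul_nonneg hδ hδ, mul_nonneg hδ (sub_nonneg.2 hs)]

lemma expQuot_anti {s δ : ℝ} (hs : 0 < s) (hδ : 0 ≤ δ) : expQuot (s + δ) ≤ expQuot s := by
  rw [expQuot, expQuot, div_le_div_iff₀ (by linarith) hs]
  have h1 : Real.exp (-(s + δ)) = Real.exp (-s) * Real.exp (-δ) := by rw [← Real.exp_add]; ring_nf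
  have h2 := Real.add_one_le_exp (-δ)
  have h3 := Real.add_one_le_exp s
  have h4 : Real.exp (-s) * Real.exp s = 1 := by rw [← Real.exp_add]; simp
  have h0 := Real.exp_pos (-s)
  rw [h1]
  nlinarith [mul_nonneg (mul_nonneg hs.le h0.le) (sub_nonneg.2 h2), mul_nonneg hδ (mul_nonneg h0.le (sub_nonneg.2 h3))]

lemma exp_neg_21_20_le : Real.exp (-(21/20)) ≤ 0.34994 := by
  rw [Real.exp_neg]
  have h := Real.sum_le_exp_of_nonneg (x := 21/20) (by norm_num) 9
  norm_num [Finset.sum_range_succ, Nat.factorial] at h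
  rw [inv_le_comm₀ (Real.exp_pos _) (by norm_num)]
  refine le_trans ?_ h
  norm_num

lemma le_exp_neg_21_20 : 0.34 ≤ Real.exp (-(21/20)) := by
  have h := Real.exp_bound_div_one_sub_of_interval (x := 1/20) (by norm_num) (by norm_num)
  have h1 := Real.exp_one_lt_d9
  have e : Real.exp (21/20) = Real.exp 1 * Real.exp (1/20) := by rw [← Real.exp_add]; norm_num
  rw [Real.exp_neg, le_inv_comm₀ (by norm_num) (Real.exp_pos _), e]
  have := Real.exp_pos 1
  norm_num at h ⊢
  nlinarith

lemma le_exp_neg_13_10 : 0.272 ≤ Real.exp (-(13/10)) := by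
  have h := Real.exp_bound (x := 3/10) (by norm_num [abs_of_pos]) (n := 4) (by norm_num)
  have h1 := Real.exp_one_lt_d9
  have e : Real.exp (13/10) = Real.exp 1 * Real.exp (3/10) := by rw [← Real.exp_add]; norm_num
  rw [Real.exp_neg, le_inv_comm₀ (by norm_num) (Real.exp_pos _), e]
  have := Real.exp_pos 1
  norm_num [Finset.sum_range_succ, Nat.factorial, abs_le] at h ⊢
  nlinarith [h.1, h.2]

/-- The exponent, per unit of `-log ‖x - y‖`, of the Chernoff bound at the scale `b` with tilt `τ`. -/
noncomputable def tiltExponent (τ a b : ℝ) : ℝ :=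
  expQuot (2 * a) - 2 * τ * expQuot (a + b) + τ ^ 2 * (1 / (2 * b) + expQuot (2 * b))

lemma expQuot_le_of_ge {s : ℝ} (hs : 1.3 ≤ s) : expQuot s ≤ 0.57 := by
  have h1 := le_exp_neg_13_10
  have h2 := Real.add_one_le_exp (-(s - 1.3))
  have e : Real.exp (-s) = Real.exp (-(13/10)) * Real.exp (-(s - 1.3)) := by
    rw [← Real.exp_add]; norm_num; ring
  have h3 : Real.exp (-(13/10)) ≤ 0.3 := by
    rw [Real.exp_neg, inv_le_comm₀ (Real.exp_pos _) (by norm_num)]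
    have h := Real.sum_le_exp_of_nonneg (x := 13/10) (by norm_num) 5
    norm_num [Finset.sum_range_succ, Nat.factorial] at h
    linarith
  rw [expQuot, div_le_iff₀ (by linarith), e]
  nlinarith [mul_le_mul_of_nonneg_left h2 (Real.exp_pos (-(13/10))).le]

lemma tiltExponent_le_of_le_half {a : ℝ} (ha : 0 < a) (ha' : a ≤ 1 / 2) :
    tiltExponent 0.69 a 1.05 ≤ 0.57132 := by
  have q1 := exp_neg_21_20_le
  have q2 := le_exp_neg_21_20
  set q := Real.exp (-(21/20)) with hq
  have e2 : Real.exp (-(2 * 1.05)) = q ^ 2 := by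
    rw [hq, sq, ← Real.exp_add]; norm_num
  have e1 : Real.exp (-(a + 1.05)) = q * Real.exp (-a) := by
    rw [hq, ← Real.exp_add]; norm_num
  have b1 : expQuot (2 * a) ≤ 1 - 0.56 * a := by
    have h := Real.exp_bound (x := -(2 * a)) (by rw [abs_neg, abs_of_pos] <;> linarith)
      (n := 4) (by norm_num)
    rw [abs_neg, abs_of_pos (by linarith : 0 < 2 * a)] at h
    norm_num [Finset.sum_range_succ, Nat.factorial, abs_le] at h
    rw [expQuot, div_le_iff₀ (by linarith)]
    nlinarith [h.1, mul_pos ha ha, mul_nonneg (mul_pos ha ha).le (sub_nonneg.2 ha'),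
      mul_nonneg (mul_pos (mul_pos ha ha) ha).le (sub_nonneg.2 ha')]
  have b2 : Real.exp (-a) ≤ 1 - 0.69 * a := by
    have h := Real.exp_bound (x := -a) (by rw [abs_neg, abs_of_pos] <;> linarith)
      (n := 3) (by norm_num)
    rw [abs_neg, abs_of_pos ha] at h
    norm_num [Finset.sum_range_succ, Nat.factorial, abs_le] at h
    nlinarith [h.2, mul_pos ha ha, mul_nonneg ha.le (sub_nonneg.2 ha'), mul_nonneg (mul_pos ha ha).le (sub_nonneg.2 ha')]
  have b3 : (1 - q) / 1.05 - 0.4 * a ≤ expQuot (a + 1.05) := by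
    rw [expQuot, e1, le_div_iff₀ (by linarith)]
    norm_num at b2 q2 ⊢
    nlinarith [mul_le_mul_of_nonneg_left b2 (by linarith : 0 ≤ q), mul_le_mul_of_nonneg_left q2 ha.le, mul_pos ha ha]
  have b4 : expQuot (2 * 1.05) = (1 - q ^ 2) / 2.1 := by
    rw [expQuot, e2]; norm_num
  rw [tiltExponent, b4]
  have b5 := mul_nonneg (sub_nonneg.2 q1) (by linarith : 0 ≤ 0.7 - q)
  norm_num at b1 b3 b5 q1 ⊢
  nlinarith [mul_nonneg (sub_nonneg.2 q1) (by linarith : 0 ≤ 0.7 - q)]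

lemma tiltExponent_le_of_half_le {a : ℝ} (ha : 1 / 2 ≤ a) (ha' : a ≤ 0.65) :
    tiltExponent 0.5 a 1.3 ≤ 0.57132 := by
  have q1 := le_exp_neg_13_10
  have b1 : expQuot (2 * a) ≤ 0.728 := by
    have : Real.exp (-(13/10)) ≤ Real.exp (-(2 * a)) := Real.exp_le_exp.2 (by linarith)
    rw [expQuot, div_le_iff₀ (by linarith)]
    linarith
  have b2 : 0.4 ≤ expQuot (a + 1.3) := by
    have : Real.exp (-(a + 1.3)) ≤ 0.2 := by
      rw [Real.exp_neg, inv_le_comm₀ (Real.exp_pos _) (by norm_num)]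
      have h := Real.sum_le_exp_of_nonneg (x := 1.8) (by norm_num) 5
      norm_num [Finset.sum_range_succ, Nat.factorial] at h
      have : Real.exp (9/5) ≤ Real.exp (a + 1.3) := Real.exp_le_exp.2 (by linarith)
      linarith
    rw [expQuot, le_div_iff₀ (by linarith)]
    linarith
  have b3 : expQuot (2 * 1.3) ≤ 1 / 2.6 := by
    have := Real.exp_pos (-(2 * 1.3))
    rw [expQuot, show (2 * 1.3 : ℝ) = 2.6 by norm_num] at *
    gcongr
    linarith
  rw [tiltExponent]
  linarith

lemma exists_tiltExponent_le {a : ℝ} (ha : 0 < a) (ha' : a ≤ 0.65) :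
    ∃ τ b : ℝ, 0 ≤ τ ∧ τ ≤ 1 ∧ 1 ≤ b ∧ b ≤ 1.3 ∧ 2 * a ≤ b ∧ tiltExponent τ a b ≤ 0.57132 := by
  rcases le_total a (1 / 2) with h | h
  · exact ⟨0.69, 1.05, by norm_num, by norm_num, by norm_num, by norm_num, by linarith,
      tiltExponent_le_of_le_half ha h⟩
  · exact ⟨0.5, 1.3, by norm_num, by norm_num, by norm_num, by norm_num, by linarith,
      tiltExponent_le_of_half_le h ha'⟩

lemma tiltExponent_le_add {τ a b b' : ℝ} (hτ : 0 ≤ τ) (hτ' : τ ≤ 1) (ha : 0 < a) (hb : 1 ≤ b)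
    (hbb : b ≤ b') : tiltExponent τ a b' ≤ tiltExponent τ a b + 2 * (b' - b) := by
  have h1 := expQuot_sub_le (s := a + b) (δ := b' - b) (by linarith) (by linarith)
  have h2 := expQuot_anti (s := 2 * b) (δ := 2 * (b' - b)) (by linarith) (by linarith)
  have h3 : 1 / (2 * b') ≤ 1 / (2 * b) := by gcongr
  rw [show a + b + (b' - b) = a + b' by ring] at h1
  rw [show 2 * b + 2 * (b' - b) = 2 * b' by ring] at h2
  have h4 := mul_le_mul_of_nonneg_left (add_le_add h3 h2) (sq_nonneg τ)
  have h5 := mul_le_mul_of_nonneg_left h1 hτ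
  have h6 := mul_nonneg (sub_nonneg.2 hτ') (sub_nonneg.2 hbb)
  rw [tiltExponent, tiltExponent]
  linarith

lemma exists_nat_scale {L Hb H b : ℝ} (hH : 0 < H) (hHb : H ≤ Hb / 2) (hHb' : Hb ≤ 0.000001)
    (hL : 2 / Hb < L) (hb : 1 ≤ b) (hb' : b ≤ 1.3) (hab : 2 * (H * L) ≤ b) :
    ∃ n : ℕ, 1 / (Hb - H) < n ∧ (n : ℝ) ≤ 1 / H ∧ b ≤ (H + 1 / n) * L ∧
      (H + 1 / n) * L ≤ b + 0.00001 := by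
  have hHb0 : 0 < Hb := by linarith
  have hL2 : 2 < L * Hb := (div_lt_iff₀ hHb0).1 hL
  have hL1 : 2000000 < L := by nlinarith
  have ha : 0 < H * L := mul_pos hH (by linarith)
  set c := b - H * L with hc
  have hc1 : H * L ≤ c := by linarith
  have hc0 : 0 < c := by linarith
  have hn1 : (⌊L / c⌋₊ : ℝ) ≤ L / c := Nat.floor_le (by positivity)
  have hn2 : L / c < ⌊L / c⌋₊ + 1 := Nat.lt_floor_add_one _
  set n := ⌊L / c⌋₊
  rw [le_div_iff₀ hc0] at hn1
  rw [div_lt_iff₀ hc0] at hn2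
  have hn0 : 1000000 < (n : ℝ) := by nlinarith
  have hn00 : 0 < (n : ℝ) := by linarith
  have e : (H + 1 / n) * L = H * L + L / n := by field_simp
  have u1 : c ≤ L / n := by rw [le_div_iff₀ hn00]; linarith
  have u2 : L / n ≤ c + 0.00001 := by rw [div_le_iff₀ hn00]; nlinarith
  refine ⟨n, ?_, ?_, by rw [e]; linarith, by rw [e]; linarith⟩
  · rw [div_lt_comm₀ (by linarith) hn00]
    have : (H + 1 / n) * L < Hb * L := by rw [e]; linarith
    have := lt_of_mul_lt_mul_right this (by linarith)
    linarith
  · rw [le_div_iff₀ hH]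
    nlinarith

lemma one_sub_rpow_div_eq {r s : ℝ} (hr : 0 < r) (hr1 : r < 1) :
    (1 - r ^ s) / s = -Real.log r * expQuot (s * -Real.log r) := by
  have hL : Real.log r ≠ 0 := (Real.log_neg hr hr1).ne
  rw [expQuot, Real.rpow_def_of_pos hr]
  rw [show -(s * -Real.log r) = Real.log r * s by ring]
  rcases eq_or_ne s 0 with rfl | hs
  · simp
  · field_simp

lemma abs_mul_add_sub_le {C Q S B : ℝ} (hC : |C - 1| ≤ 0.000001) (hQ : 0 ≤ Q) (hS : |S| ≤ B) :
    |C * (Q + S) - Q| ≤ 0.000001 * Q + 2 * B := by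
  have h : C * (Q + S) - Q = (C - 1) * (Q + S) + S := by ring
  have h1 : |Q + S| ≤ Q + B := (abs_add_le Q S).trans (by rw [abs_of_nonneg hQ]; linarith)
  have h2 : |(C - 1) * (Q + S)| ≤ 0.000001 * (Q + B) := by
    rw [abs_mul]; exact mul_le_mul hC h1 (abs_nonneg _) (by norm_num)
  rw [h]
  linarith [abs_add_le ((C - 1) * (Q + S)) S, (abs_nonneg S).trans hS]

lemma tilted_exponent_le {H h L τ γ α K C₁ C₂ C₃ S₁ S₂ : ℝ} (hH : 0 < H) (hh : 0 < h)
    (hL : 0 < L) (hτ : 0 ≤ τ) (hτ' : τ ≤ 1) (hb : 1 ≤ h * L) (hγ : 0 ≤ γ)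
    (hα : α ≤ γ * (1 + 0.000001)) (hC₁ : |C₁ - 1| ≤ 0.000001) (hC₂ : |C₂ - 1| ≤ 0.000001)
    (hC₃ : |C₃ - 1| ≤ 0.000001) (hS₁ : |S₁| ≤ 4 * K) (hS₂ : |S₂| ≤ 4 * K) (hK : 12 * K ≤ 0.000001 * L)
    (hF : tiltExponent τ (H * L) (h * L) ≤ 0.57135) :
    C₁ * γ ^ 2 * (L * expQuot (2 * H * L)) +
      (-(γ * (γ * τ) * (C₂ * (2 / (H + h) + 2 * (L * expQuot ((H + h) * L)) + S₁))) +
        (γ * τ) ^ 2 / 2 * (C₃ * (1 / h + 2 * (L * expQuot (2 * h * L)) + S₂)) +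
        γ * τ * (2 * α / (h + H))) ≤ γ ^ 2 * (0.5714 * L) := by
  have ha : 0 < H * L := mul_pos hH hL
  have hhL : 0 < h * L := mul_pos hh hL
  have hz0 : 0 < 1 / h := by positivity
  have hz1 : 1 / h ≤ L := by rw [div_le_iff₀ hh]; linarith
  have hu0 : 0 < 1 / (H + h) := by positivity
  have hu1 : 1 / (H + h) ≤ L := le_trans (by gcongr; linarith) hz1
  rw [tiltExponent, show 2 * (H * L) = 2 * H * L by ring, show 2 * (h * L) = 2 * h * L by ring,
    show H * L + h * L = (H + h) * L by ring] at hF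
  have hp0 := expQuot_nonneg (s := 2 * H * L) (by positivity)
  have hp1 := expQuot_le_one (s := 2 * H * L) (by positivity)
  have hq0 := expQuot_nonneg (s := (H + h) * L) (by positivity)
  have hq1 := expQuot_le_one (s := (H + h) * L) (by positivity)
  have hw0 := expQuot_nonneg (s := 2 * h * L) (by positivity)
  have hw1 := expQuot_le_one (s := 2 * h * L) (by positivity)
  have hz : 1 / (2 * h * L) * L = 1 / h / 2 := by field_simp
  have hu : 2 / (H + h) = 2 * (1 / (H + h)) := by ring
  have hu' : 2 * α / (h + H) = 2 * α * (1 / (H + h)) := by rw [add_comm h H]; ring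
  rw [hu, hu']
  generalize expQuot (2 * H * L) = p at *
  generalize expQuot ((H + h) * L) = q at *
  generalize expQuot (2 * h * L) = w at *
  generalize 1 / (H + h) = u at *
  generalize 1 / h = z at *
  generalize 1 / (2 * h * L) = k at *
  have hLp := mul_nonneg hL.le hp0
  have hLp' := mul_le_mul_of_nonneg_left hp1 hL.le
  have hLq := mul_nonneg hL.le hq0
  have hLq' := mul_le_mul_of_nonneg_left hq1 hL.le
  have hLw := mul_nonneg hL.le hw0
  have hLw' := mul_le_mul_of_nonneg_left hw1 hL.le
  have t1 := (abs_le.1 (abs_mul_add_sub_le hC₁ hLp (abs_zero.le : |(0 : ℝ)| ≤ 0))).2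
  have t2 := (abs_le.1 (abs_mul_add_sub_le hC₂ (by linarith : 0 ≤ 2 * u + 2 * (L * q)) hS₁)).1
  have t3 := (abs_le.1 (abs_mul_add_sub_le hC₃ (by linarith : 0 ≤ z + 2 * (L * w)) hS₂)).2
  replace t1 : C₁ * (L * p) ≤ L * p + 0.000001 * L := by linarith
  replace t2 : 2 * u + 2 * (L * q) - 0.000004 * L - 8 * K ≤ C₂ * (2 * u + 2 * (L * q) + S₁) := by
    linarith
  replace t3 : C₃ * (z + 2 * (L * w) + S₂) ≤ z + 2 * (L * w) + 0.000003 * L + 8 * K := by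
    linarith
  have t4 : 2 * α * u ≤ γ * (2 * u + 0.000002 * L) := by
    have e1 := mul_le_mul_of_nonneg_right hα hu0.le
    have e2 := mul_le_mul_of_nonneg_left hu1 hγ
    nlinarith
  have hFL := mul_le_mul_of_nonneg_right hF hL.le
  have hτ2 : τ ^ 2 ≤ 1 := pow_le_one₀ hτ hτ'
  have hKL : 0 ≤ K := by linarith [(abs_nonneg S₁).trans hS₁]
  have s2 := mul_le_mul_of_nonneg_left t2 hτ
  have s3 := mul_le_mul_of_nonneg_left t3 (sq_nonneg τ)
  have s5 := mul_le_mul_of_nonneg_right hτ' (by positivity : 0 ≤ 0.000006 * L + 8 * K)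
  have s6 := mul_le_mul_of_nonneg_right hτ2 (by positivity : 0 ≤ 0.000003 * L + 8 * K)
  have hk : τ ^ 2 * (k * L) = τ ^ 2 * (z / 2) := by rw [hz]
  have main : C₁ * (L * p) - τ * (C₂ * (2 * u + 2 * (L * q) + S₁)) +
      τ ^ 2 / 2 * (C₃ * (z + 2 * (L * w) + S₂)) + τ * (2 * u + 0.000002 * L) ≤ 0.5714 * L := by
    linear_combination t1 + s2 + s3 / 2 + hFL + s5 + s6 / 2 - hk + hK + 0.0000405 * hL
  have m1 := mul_le_mul_of_nonneg_left main (sq_nonneg γ)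
  have m2 := mul_le_mul_of_nonneg_left t4 (mul_nonneg hγ hτ)
  linear_combination m1 + m2

lemma integrable_indicator_norm_rpow {d : ℕ} (hd : 1 ≤ d) {p : ℝ} (hp : p < d) :
    Integrable (fun z : EuclideanSpace ℝ (Fin d) =>
      (Iio (1 : ℝ)).indicator (fun y => y ^ (-p)) ‖z‖) := by
  have : Nonempty (Fin d) := ⟨⟨0, hd⟩⟩
  rw [integrable_fun_norm_addHaar, finrank_euclideanSpace_fin]
  have h : IntegrableOn (fun y : ℝ => y ^ ((d : ℝ) - 1 - p)) (Ioo 0 1) :=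
    (intervalIntegral.integrableOn_Ioo_rpow_iff one_pos).2 (by linarith)
  rw [← integrable_indicator_iff measurableSet_Ioo] at h
  rw [← integrable_indicator_iff measurableSet_Ioi]
  refine h.congr (ae_of_all _ fun y => ?_)
  by_cases h0 : 0 < y
  · by_cases h1 : y < 1
    · have e : (y : ℝ) ^ ((d : ℝ) - 1 - p) = y ^ (d - 1) * y ^ (-p) := by
        rw [← Real.rpow_natCast, ← Real.rpow_add h0]
        push_cast [Nat.cast_sub hd]
        ring_nf
      simp [indicator, h0, h1, e]
    · simp [indicator, h0, h1]
  · simp [indicator, h0]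

lemma setIntegral_setIntegral_le {d : ℕ} {D : Set (EuclideanSpace ℝ (Fin d))}
    (hD : MeasurableSet D) (hDfin : volume D ≠ ⊤)
    {f : EuclideanSpace ℝ (Fin d) → EuclideanSpace ℝ (Fin d) → ℝ}
    {ψ : EuclideanSpace ℝ (Fin d) → ℝ} (hψ : Integrable ψ) (hf : ∀ x y, 0 ≤ f x y)
    (hψ0 : ∀ z, 0 ≤ ψ z) (hfψ : ∀ x ∈ D, ∀ y ∈ D, f x y ≤ ψ (x - y)) :
    ∫ x in D, ∫ y in D, f x y ≤ ∫ _ in D, ∫ z, ψ z := by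
  refine integral_mono_of_nonneg (ae_of_all _ fun x => integral_nonneg (hf x))
    (integrableOn_const hDfin) (ae_restrict_of_forall_mem hD fun x hx => ?_)
  have hi : Integrable (fun y => ψ (x - y)) := hψ.comp_sub_left x
  calc ∫ y in D, f x y ≤ ∫ y in D, ψ (x - y) :=
        integral_mono_of_nonneg (ae_of_all _ (hf x)) hi.integrableOn
          (ae_restrict_of_forall_mem hD fun y hy => hfψ x hx y hy)
    _ ≤ ∫ y, ψ (x - y) := setIntegral_le_integral hi (ae_of_all _ fun y => hψ0 _)
    _ = ∫ z, ψ z := integral_sub_left_eq_self ψ volume x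

lemma integral_pair_sum_mul {Ω E : Type*} [MeasurableSpace Ω] [NormedAddCommGroup E]
    {P : Measure Ω} {X : ℝ → E → Ω → ℝ} {D : Set E} {H h c : ℝ} {G : E → E → ℝ}
    (hHh : 0 < H + h)
    (hXH : ∀ x ∈ D, MemLp (X H x) 2 P) (hXh : ∀ x ∈ D, MemLp (X h x) 2 P)
    (hcov : ∀ x ∈ D, ∀ y ∈ D, ∫ ω, X H x ω * X h y ω ∂P =
      c * ((1 - ‖x - y‖ ^ (H + h)) / (H + h) + G x y)) {x y : E} (hx : x ∈ D) (hy : y ∈ D) :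
    ∫ ω, (X H x ω + X H y ω) * (X h x ω + X h y ω) ∂P =
      c * (2 / (H + h) + 2 * ((1 - ‖x - y‖ ^ (H + h)) / (H + h)) +
        (G x x + G x y + G y x + G y y)) := by
  have i : ∀ x ∈ D, ∀ y ∈ D, Integrable (fun ω => X H x ω * X h y ω) P :=
    fun x hx y hy => (hXH x hx).integrable_mul (hXh y hy)
  have e : (fun ω => (X H x ω + X H y ω) * (X h x ω + X h y ω)) = fun ω =>
      (X H x ω * X h x ω + X H x ω * X h y ω) + (X H y ω * X h x ω + X H y ω * X h y ω) := by
    ext ω; ring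
  rw [e, integral_add (f := fun ω => X H x ω * X h x ω + X H x ω * X h y ω)
      (g := fun ω => X H y ω * X h x ω + X H y ω * X h y ω)
      ((i x hx x hx).add (i x hx y hy)) ((i y hy x hx).add (i y hy y hy)),
    integral_add (i x hx x hx) (i x hx y hy), integral_add (i y hy x hx) (i y hy y hy),
    hcov x hx x hx, hcov x hx y hy, hcov y hy x hx, hcov y hy y hy, norm_sub_rev y x]
  simp only [sub_self, norm_zero, Real.zero_rpow hHh.ne']
  ring

theorem stmt_6
    {d : ℕ} (hd : 1 ≤ d)
    {Ω : Type} [MeasurableSpace Ω] (P : Measure Ω) [IsProbabilityMeasure P]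
    (D : Set (EuclideanSpace ℝ (Fin d)))
    (hDopen : IsOpen D) (hDconn : IsConnected D) (hDbdd : Bornology.IsBounded D)
    (H₀ : ℝ) (hH₀ : H₀ ∈ Set.Ioo (0 : ℝ) (1/2))
    (X : ℝ → EuclideanSpace ℝ (Fin d) → Ω → ℝ)
    (hXmeas : Measurable fun p : ℝ × EuclideanSpace ℝ (Fin d) × Ω => X p.1 p.2.1 p.2.2)
    (C : ℝ → ℝ → ℝ) (G : ℝ → ℝ → EuclideanSpace ℝ (Fin d) → EuclideanSpace ℝ (Fin d) → ℝ)
    (g : EuclideanSpace ℝ (Fin d) → EuclideanSpace ℝ (Fin d) → ℝ)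
    (hCpos : ∀ H h : ℝ, H ∈ Set.Ioo 0 H₀ → h ∈ Set.Ioo 0 H₀ → 0 < C H h)
    (hGbdd : ∀ H h : ℝ, H ∈ Set.Ioo 0 H₀ → h ∈ Set.Ioo 0 H₀ →
      ∃ K : ℝ, ∀ x ∈ D, ∀ y ∈ D, |G H h x y| ≤ K)
    (hgauss : ∀ (n : ℕ) (c : Fin n → ℝ) (Hs : Fin n → ℝ) (xs : Fin n → EuclideanSpace ℝ (Fin d)),
      (∀ i, Hs i ∈ Set.Ioo 0 H₀) → (∀ i, xs i ∈ D) →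
      ∃ v : NNReal, P.map (fun ω => ∑ i, c i * X (Hs i) (xs i) ω) = gaussianReal 0 v)
    (hcov : ∀ H h : ℝ, H ∈ Set.Ioo 0 H₀ → h ∈ Set.Ioo 0 H₀ → ∀ x ∈ D, ∀ y ∈ D,
      ∫ ω, X H x ω * X h y ω ∂P =
        C H h * ((1 - ‖x - y‖ ^ (H + h)) / (H + h) + G H h x y))
    (hA1 : ∀ ε > (0 : ℝ), ∃ η > (0 : ℝ), ∀ H h : ℝ,
      H ∈ Set.Ioo 0 (min η H₀) → h ∈ Set.Ioo 0 (min η H₀) → |C H h - 1| ≤ ε)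
    (hgbdd : ∃ K : ℝ, ∀ x ∈ D, ∀ y ∈ D, |g x y| ≤ K)
    (hA2 : ∀ ε > (0 : ℝ), ∃ η > (0 : ℝ), ∀ H h : ℝ,
      H ∈ Set.Ioo 0 (min η H₀) → h ∈ Set.Ioo 0 (min η H₀) →
      ∀ x ∈ D, ∀ y ∈ D, |G H h x y - g x y| ≤ ε)
    :
    ∃ κstar : ℝ, κstar > 1 ∧ ∃ γstar : ℝ, γstar > Real.sqrt (7 * d / 4) ∧
      ∀ γ ∈ Set.Ioc (0 : ℝ) γstar, ∃ α₀ > γ, ∀ α ∈ Set.Ioo γ α₀,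
        ∃ Hb ∈ Set.Ioo (0 : ℝ) H₀, ∃ K : ℝ,
          ∀ H ∈ Set.Ioc (0 : ℝ) (Hb / 2),
            (∫ x in D, ∫ y in D,
              (if Real.exp (-(κstar / H)) ≤ ‖x - y‖ ∧ ‖x - y‖ < Real.exp (-(2 / Hb)) then
                Real.exp (C H H * γ ^ 2 * (1 - ‖x - y‖ ^ (2 * H)) / (2 * H)) *
                  ∫ ω in
                    ({ω' | ∀ h ∈ {h : ℝ | ∃ n : ℕ, h = H + 1 / n ∧
                        1 / (Hb - H) < (n : ℝ) ∧ (n : ℝ) ≤ 1 / H},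
                      X h x ω' ≤ α / (h + H)} ∩
                     {ω' | ∀ h ∈ {h : ℝ | ∃ n : ℕ, h = H + 1 / n ∧
                        1 / (Hb - H) < (n : ℝ) ∧ (n : ℝ) ≤ 1 / H},
                      X h y ω' ≤ α / (h + H)}),
                    Real.exp (γ * X H x ω + γ * X H y ω -
                      γ ^ 2 / 2 * ∫ ω', (X H x ω' + X H y ω') ^ 2 ∂P) ∂P
              else 0)) ≤ K := by
  have hXm : ∀ h x, Measurable (X h x) := fun h x =>
    hXmeas.comp (measurable_const.prodMk (measurable_const.prodMk measurable_id))
  have hd0 : (0 : ℝ) < d := by exact_mod_cast hd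
  obtain ⟨Kg, hKg⟩ := hgbdd
  obtain ⟨η₁, hη₁, hC⟩ := hA1 0.000001 (by norm_num)
  obtain ⟨η₂, hη₂, hGg⟩ := hA2 1 one_pos
  set K := |Kg| + 1 with hK
  have hK0 : 0 < K := by positivity
  have hL2 : ∀ h ∈ Ioo 0 H₀, ∀ x ∈ D, MemLp (X h x) 2 P := by
    intro h hh x hx
    obtain ⟨v, hv⟩ := hgauss 1 (fun _ => 1) (fun _ => h) (fun _ => x) (fun _ => hh) (fun _ => hx)
    refine memLp_of_map_eq_gaussianReal (hXm h x) (v := v) ?_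
    simpa using hv
  refine ⟨2, by norm_num, √(1.75005 * d), Real.sqrt_lt_sqrt (by positivity) (by nlinarith),
    fun γ hγ => ⟨γ * (1 + 0.000001), by nlinarith [hγ.1], fun α hα => ?_⟩⟩
  have hγ0 : 0 ≤ γ := hγ.1.le
  have hγ2 : γ ^ 2 ≤ 1.75005 * d := (Real.le_sqrt hγ0 (by positivity)).1 hγ.2
  obtain ⟨Hb, hHb0, hHb1, hHb2, hHb3, hHb4, hHb5⟩ : ∃ Hb : ℝ, 0 < Hb ∧ Hb ≤ 0.000001 ∧ Hb < H₀ ∧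
      Hb < η₁ ∧ Hb < η₂ ∧ Hb ≤ 0.0000001 / K := by
    have hH₀' := hH₀.1
    refine ⟨min 0.000001 (min (H₀ / 2) (min (η₁ / 2) (min (η₂ / 2) (0.0000001 / K)))), ?_, ?_, ?_, ?_, ?_, ?_⟩
    · simp only [lt_min_iff]
      refine ⟨by norm_num, by positivity, by positivity, by positivity, by positivity⟩
    · exact min_le_left _ _
    · exact (by simp : _ ≤ H₀ / 2).trans_lt (by linarith)
    · exact (by simp : _ ≤ η₁ / 2).trans_lt (by linarith)
    · exact (by simp : _ ≤ η₂ / 2).trans_lt (by linarith)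
    · simp
  refine ⟨Hb, ⟨hHb0, hHb2⟩, _, fun H hH => setIntegral_setIntegral_le hDopen.measurableSet
    hDbdd.measure_lt_top.ne (integrable_indicator_norm_rpow hd (p := 0.99999 * d) (by linarith))
    (fun x y => ?_) (fun z => indicator_apply_nonneg (fun _ => Real.rpow_nonneg (norm_nonneg z) _))
    (fun x hx y hy => ?_)⟩
  · split_ifs
    · exact mul_nonneg (Real.exp_pos _).le (integral_nonneg fun ω => (Real.exp_pos _).le)
    · exact le_rfl
  split_ifs with hr
  swap
  · exact indicator_apply_nonneg (fun _ => Real.rpow_nonneg (norm_nonneg _) _)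
  obtain ⟨hr1, hr2⟩ := hr
  set r := ‖x - y‖ with hrdef
  have hr0 : 0 < r := (Real.exp_pos _).trans_le hr1
  have hr3 : r < 1 := hr2.trans (Real.exp_lt_one_iff.2 (by have := div_pos two_pos hHb0; linarith))
  set L := -Real.log r with hLdef
  have hLHb : 2 / Hb < L := by
    have := (Real.log_lt_iff_lt_exp hr0).2 hr2
    linarith
  have hL0 : 0 < L := (div_pos two_pos hHb0).trans hLHb
  have hKL : 12 * K ≤ 0.000001 * L := by
    rw [le_div_iff₀ hK0] at hHb5
    rw [div_lt_iff₀ hHb0] at hLHb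
    have : 12 * K * Hb ≤ 0.000001 * L * Hb := by linarith
    exact le_of_mul_le_mul_right this hHb0
  have hH0 : 0 < H := hH.1
  have hHHb := hH.2
  have hIoo : ∀ h : ℝ, 0 < h → h < Hb → h ∈ Ioo 0 H₀ ∧ h ∈ Ioo 0 (min η₁ H₀) ∧
      h ∈ Ioo 0 (min η₂ H₀) := fun h h0 h1 =>
    ⟨⟨h0, by linarith⟩, ⟨h0, lt_min (by linarith) (by linarith)⟩,
      ⟨h0, lt_min (by linarith) (by linarith)⟩⟩
  obtain ⟨hHm, hHm1, hHm2⟩ := hIoo H hH0 (by linarith)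
  have hGK : ∀ a ∈ Ioo 0 (min η₂ H₀), ∀ b ∈ Ioo 0 (min η₂ H₀),
      |G a b x x + G a b x y + G a b y x + G a b y y| ≤ 4 * K := by
    intro a ha b hb
    have h1 : ∀ u ∈ D, ∀ w ∈ D, |G a b u w| ≤ K := fun u hu w hw => by
      have e : G a b u w = (G a b u w - g u w) + g u w := by ring
      rw [e]
      linarith [abs_add_le (G a b u w - g u w) (g u w), hGg a b ha hb u hu w hw,
        hKg u hu w hw, le_abs_self Kg]
    linarith [abs_add_le (G a b x x + G a b x y + G a b y x) (G a b y y),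
      abs_add_le (G a b x x + G a b x y) (G a b y x), abs_add_le (G a b x x) (G a b x y),
      h1 x hx x hx, h1 x hx y hy, h1 y hy x hx, h1 y hy y hy]
  have hgauss4 : ∀ h ∈ Ioo 0 H₀, ∀ p q : ℝ, ∃ v : NNReal,
      P.map (fun ω => p * (X H x ω + X H y ω) + q * (X h x ω + X h y ω)) = gaussianReal 0 v := by
    intro h hh p q
    obtain ⟨v, hv⟩ := hgauss 4 ![p, p, q, q] ![H, H, h, h] ![x, y, x, y]
      (by intro i; fin_cases i <;> simpa using by assumption)
      (by intro i; fin_cases i <;> simpa using by assumption)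
    refine ⟨v, ?_⟩
    rw [← hv]
    congr 1
    ext ω
    simp [Fin.sum_univ_four]
    ring
  have hψ : (Iio (1 : ℝ)).indicator (fun y => y ^ (-(0.99999 * (d : ℝ)))) r =
      Real.exp (0.99999 * d * L) := by
    rw [indicator_of_mem (show r ∈ Iio 1 from hr3), Real.rpow_def_of_pos hr0, hLdef]
    ring_nf
  have hfin : γ ^ 2 * (0.5714 * L) ≤ 0.99999 * d * L := by
    have := mul_le_mul_of_nonneg_right hγ2 hL0.le
    nlinarith [mul_pos hd0 hL0]
  rw [hψ, mul_div_assoc, one_sub_rpow_div_eq hr0 hr3]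
  simp only [← mul_add, ← hLdef]
  have hCH := hC H H hHm1 hHm1
  rcases le_or_gt (H * L) 0.65 with ha | ha
  · obtain ⟨τ, b, hτ, hτ', hb, hb', hab, hF⟩ := exists_tiltExponent_le (mul_pos hH0 hL0) ha
    obtain ⟨n, hn1, hn2, hn3, hn4⟩ := exists_nat_scale hH0 hHHb hHb1 hLHb hb hb' hab
    set h := H + 1 / (n : ℝ) with hh
    have hn0 : 0 < (n : ℝ) := (one_div_pos.2 (by linarith)).trans hn1
    have hh0 : 0 < h := by positivity
    have hhHb : h < Hb := by
      rw [div_lt_comm₀ (by linarith) hn0] at hn1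
      linarith
    obtain ⟨hhm, hhm1, hhm2⟩ := hIoo h hh0 hhHb
    have hF' : tiltExponent τ (H * L) (h * L) ≤ 0.57135 := by
      have := tiltExponent_le_add hτ hτ' (mul_pos hH0 hL0) hb hn3
      linarith
    have hbound := setIntegral_exp_tilt_le P (W := fun ω => X H x ω + X H y ω)
      (Y := fun ω => X h x ω + X h y ω) ((hXm H x).add (hXm H y)) ((hXm h x).add (hXm h y))
      (hgauss4 h hhm)
      (S := {ω' | ∀ h ∈ {h : ℝ | ∃ n : ℕ, h = H + 1 / n ∧
            1 / (Hb - H) < (n : ℝ) ∧ (n : ℝ) ≤ 1 / H}, X h x ω' ≤ α / (h + H)} ∩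
          {ω' | ∀ h ∈ {h : ℝ | ∃ n : ℕ, h = H + 1 / n ∧
            1 / (Hb - H) < (n : ℝ) ∧ (n : ℝ) ≤ 1 / H}, X h y ω' ≤ α / (h + H)})
      (β := 2 * α / (h + H)) (t := γ * τ) (γ := γ) (mul_nonneg hγ0 hτ) (by
        rintro ω ⟨h1, h2⟩
        have h3 := h1 h ⟨n, rfl, hn1, hn2⟩
        have h4 := h2 h ⟨n, rfl, hn1, hn2⟩
        rw [mul_div_assoc, two_mul]
        exact add_le_add h3 h4)
    have eM := integral_pair_sum_mul (P := P) (by linarith) (hL2 H hHm) (hL2 h hhm)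
      (hcov H h hHm hhm) hx hy
    have eV := integral_pair_sum_mul (P := P) (by linarith) (hL2 h hhm) (hL2 h hhm)
      (hcov h h hhm hhm) hx hy
    simp only [← sq] at eV
    rw [eM, eV, ← hrdef, one_sub_rpow_div_eq hr0 hr3, one_sub_rpow_div_eq hr0 hr3, ← hLdef,
      ← two_mul h, show 2 / (2 * h) = 1 / h by field_simp] at hbound
    refine (mul_le_mul_of_nonneg_left hbound (Real.exp_pos _).le).trans ?_
    rw [← Real.exp_add]
    exact Real.exp_le_exp.2 ((tilted_exponent_le hH0 hh0 hL0 hτ hτ' (by linarith) hγ0 hα.2.le hCH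
      (hC H h hHm1 hhm1) (hC h h hhm1 hhm1) (hGK H hHm2 h hhm2) (hGK h hhm2 h hhm2) hKL
      hF').trans hfin)
  · have hbound := fun S => setIntegral_exp_tilt_le P (W := fun ω => X H x ω + X H y ω)
      (Y := fun _ => 0) ((hXm H x).add (hXm H y)) measurable_const
      (fun p q => by simpa using hgauss4 H hHm p 0) (S := S) (β := 0) (t := 0) (γ := γ) le_rfl
      (fun _ _ => le_rfl)
    refine (mul_le_mul_of_nonneg_left (hbound _) (Real.exp_pos _).le).trans ?_
    rw [← Real.exp_add]
    refine Real.exp_le_exp.2 (le_trans ?_ hfin)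
    have hq := expQuot_le_of_ge (s := 2 * H * L) (by linarith)
    have hCH' : C H H ≤ 1 + 0.000001 := by linarith [(abs_le.1 hCH).2]
    have h1 := mul_le_mul_of_nonneg_left hq hL0.le
    have h2 := mul_le_mul hCH' h1
      (mul_nonneg hL0.le (expQuot_nonneg (by positivity))) (by norm_num)
    have h3 := mul_le_mul_of_nonneg_left h2 (sq_nonneg γ)
    have h4 := mul_nonneg (sq_nonneg γ) hL0.le
    norm_num at h3 ⊢
    linarith
end
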